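/- Let −1/6 < s < 0. For every sufficiently small ε > 0 there exist b ∈ (1/2,1), b′ ∈ (b−1,0) and C > 0 such that for all N ≥ 1 and all Schwartz functions v₁,…,v₄ on ℝ²: ‖ M^∨(v₁,v₂,v₃,v₄) ‖_{X^{0,b′}} ≤ C N^{−1/2+ε} ∏_{j=1}^4 ‖v_j‖_{X^{0,b}}, where M(ξ₁,…,ξ₄) = ( m(ξ₁)²ξ₁ + m(ξ₂)²ξ₂ + m(ξ₃)²ξ₃ + m(ξ₄)²ξ₄ + m(ξ₅)²ξ₅ ) / ( m(ξ₁)m(ξ₂)m(ξ₃)m(ξ₄)m(ξ₅) ) with ξ₅ = −(ξ₁+ξ₂+ξ₃+ξ₄). -/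

import Mathlib

open MeasureTheory

noncomputable section

/-- Spacetime Fourier transform on ℝ². -/
def FT2 (u : ℝ × ℝ → ℂ) (τ ξ : ℝ) : ℂ :=
  ∫ p : ℝ × ℝ, Complex.exp (-(Complex.I * ((p.1 * τ + p.2 * ξ : ℝ) : ℂ))) * u p

/-- Bourgain weight ⟨ξ⟩^{2s}⟨τ-ξ³⟩^{2b}, with ⟨x⟩ = (1+x²)^{1/2}. -/
def wgt (s b τ ξ : ℝ) : ℝ := (1 + ξ ^ 2) ^ s * (1 + (τ - ξ ^ 3) ^ 2) ^ b

/-- The Bourgain norm ‖u‖_{X^{s,b}}. -/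
def Xnorm (s b : ℝ) (u : ℝ × ℝ → ℂ) : ℝ :=
  Real.sqrt (∫ q : ℝ × ℝ, wgt s b q.1 q.2 * ‖FT2 u q.1 q.2‖ ^ 2)

/-- Extend `k-1` frequencies to `k` with the last determined by the total `tot`. -/
def padTot (k : ℕ) (tot : ℝ) (v : Fin (k - 1) → ℝ) : Fin k → ℝ :=
  fun j => if h : (j : ℕ) < k - 1 then v ⟨j, h⟩ else tot - ∑ i, v i

/-- Spacetime Fourier transform of M^∨(u₁,…,u_k) at (τ,ξ). -/
def convFT (k : ℕ) (M : (Fin k → ℝ) → ℂ) (u : Fin k → ℝ × ℝ → ℂ) (τ ξ : ℝ) : ℂ :=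
  ∫ q : Fin (k - 1) → ℝ × ℝ,
    M (padTot k ξ fun i => (q i).2) *
      ∏ j, FT2 (u j) (padTot k τ (fun i => (q i).1) j) (padTot k ξ (fun i => (q i).2) j)

/-- The Bourgain norm ‖M^∨(u₁,…,u_k)‖_{X^{s,b}}. -/
def XnormM (s b : ℝ) (k : ℕ) (M : (Fin k → ℝ) → ℂ) (u : Fin k → ℝ × ℝ → ℂ) : ℝ :=
  Real.sqrt (∫ q : ℝ × ℝ, wgt s b q.1 q.2 * ‖convFT k M u q.1 q.2‖ ^ 2)

/-- The I-method multiplier m. -/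
def mI (s N ξ : ℝ) : ℝ := if |ξ| ≤ N then 1 else (|ξ| / N) ^ s

/-- The multiplier (m₁²ξ₁+⋯+m₅²ξ₅)/(m₁⋯m₅) with ξ₅ = −(ξ₁+ξ₂+ξ₃+ξ₄). -/
def M12 (s N : ℝ) (ξ : Fin 4 → ℝ) : ℝ :=
  (mI s N (ξ 0) ^ 2 * ξ 0 + mI s N (ξ 1) ^ 2 * ξ 1 + mI s N (ξ 2) ^ 2 * ξ 2
      + mI s N (ξ 3) ^ 2 * ξ 3
      + mI s N (-(ξ 0 + ξ 1 + ξ 2 + ξ 3)) ^ 2 * (-(ξ 0 + ξ 1 + ξ 2 + ξ 3))) /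
    (mI s N (ξ 0) * mI s N (ξ 1) * mI s N (ξ 2) * mI s N (ξ 3) *
      mI s N (-(ξ 0 + ξ 1 + ξ 2 + ξ 3)))

/-- The weight `(1 + |x|)^(-α)` as an extended nonnegative real. -/
def jw (α x : ℝ) : ENNReal := ENNReal.ofReal ((1 + |x|) ^ (-α))

@[fun_prop]
lemma measurable_jw (α : ℝ) : Measurable (jw α) := by
  unfold jw; fun_prop

lemma jw_neg (α x : ℝ) : jw α (-x) = jw α x := by simp [jw]

lemma jw_anti {α β : ℝ} (h : β ≤ α) (x : ℝ) : jw α x ≤ jw β x := by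
  unfold jw
  apply ENNReal.ofReal_le_ofReal
  apply Real.rpow_le_rpow_of_exponent_le
  · linarith [abs_nonneg x]
  · linarith

lemma lintegral_jw_lt_top {α : ℝ} (h : 1 < α) : ∫⁻ x, jw α x < ⊤ := by
  have := finite_integral_one_add_norm (E := ℝ) (μ := volume) (r := α) (by simpa using h)
  simpa [jw] using this

lemma one_add_abs_rpow_mul_le_aux {α γ : ℝ} (hγ : 0 ≤ γ) (hγα : γ ≤ α) {x y : ℝ} (hxy : |x| ≤ |y|) :
    (1 + |x|) ^ (-α) * (1 + |y|) ^ (-α) ≤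
      2 ^ γ * (1 + |x + y|) ^ (-γ) * (1 + |x|) ^ (-(2 * α - γ)) := by
  have hu : 0 < 1 + |x| := by positivity
  have hv : 0 < 1 + |y| := by positivity
  have hs : 0 < 1 + |x + y| := by positivity
  have h1 : (1 + |y|) ^ (-γ) ≤ 2 ^ γ * (1 + |x + y|) ^ (-γ) := by
    have h2 : (1 + |x + y|) / 2 ≤ 1 + |y| := by linarith [abs_add_le x y]
    calc (1 + |y|) ^ (-γ) ≤ ((1 + |x + y|) / 2) ^ (-γ) :=
          Real.rpow_le_rpow_of_nonpos (by positivity) h2 (by linarith)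
      _ = _ := by
          rw [Real.div_rpow hs.le (by norm_num), Real.rpow_neg (by norm_num : (0:ℝ) ≤ 2), div_inv_eq_mul,
            mul_comm]
  have h3 : (1 + |y|) ^ (-(α - γ)) ≤ (1 + |x|) ^ (-(α - γ)) :=
    Real.rpow_le_rpow_of_nonpos hu (by linarith) (by linarith)
  calc (1 + |x|) ^ (-α) * (1 + |y|) ^ (-α)
      = (1 + |x|) ^ (-α) * ((1 + |y|) ^ (-γ) * (1 + |y|) ^ (-(α - γ))) := by
        rw [← Real.rpow_add hv]; ring_nf
    _ ≤ (1 + |x|) ^ (-α) * ((2 ^ γ * (1 + |x + y|) ^ (-γ)) * (1 + |x|) ^ (-(α - γ))) := by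
        gcongr
    _ = 2 ^ γ * (1 + |x + y|) ^ (-γ) * ((1 + |x|) ^ (-α) * (1 + |x|) ^ (-(α - γ))) := by ring
    _ = _ := by rw [← Real.rpow_add hu]; ring_nf

lemma jw_mul_jw_le {α γ : ℝ} (hγ : 0 ≤ γ) (hγα : γ ≤ α) (x y : ℝ) :
    jw α x * jw α y ≤
      ENNReal.ofReal (2 ^ γ) * jw γ (x + y) * (jw (2 * α - γ) x + jw (2 * α - γ) y) := by
  unfold jw
  rw [← ENNReal.ofReal_add (by positivity) (by positivity), ← ENNReal.ofReal_mul (by positivity),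
    ← ENNReal.ofReal_mul (by positivity), ← ENNReal.ofReal_mul (by positivity)]
  apply ENNReal.ofReal_le_ofReal
  rw [mul_add]
  have hx : 0 ≤ 2 ^ γ * (1 + |x + y|) ^ (-γ) * (1 + |x|) ^ (-(2 * α - γ)) := by positivity
  have hy : 0 ≤ 2 ^ γ * (1 + |x + y|) ^ (-γ) * (1 + |y|) ^ (-(2 * α - γ)) := by positivity
  rcases le_total |x| |y| with h | h
  · linarith [one_add_abs_rpow_mul_le_aux hγ hγα h]
  · have := one_add_abs_rpow_mul_le_aux hγ hγα h
    rw [add_comm y x] at this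
    linarith

lemma exists_lintegral_jw_mul_jw_le {α γ : ℝ} (hγ : 0 ≤ γ) (hγα : γ ≤ α) (h : 1 < 2 * α - γ) :
    ∃ C : ENNReal, C ≠ ⊤ ∧ ∀ x a : ℝ, ∫⁻ t, jw α (t - a) * jw α (x - t) ≤ C * jw γ (x - a) := by
  have hI := lintegral_jw_lt_top h
  refine ⟨ENNReal.ofReal (2 ^ γ) * ((∫⁻ x, jw (2 * α - γ) x) + ∫⁻ x, jw (2 * α - γ) x), ?_, ?_⟩
  · exact ENNReal.mul_ne_top ENNReal.ofReal_ne_top (ENNReal.add_ne_top.2 ⟨hI.ne, hI.ne⟩)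
  intro x a
  calc ∫⁻ t, jw α (t - a) * jw α (x - t)
      ≤ ∫⁻ t, ENNReal.ofReal (2 ^ γ) * jw γ (x - a) *
          (jw (2 * α - γ) (t - a) + jw (2 * α - γ) (x - t)) := by
        apply lintegral_mono
        intro t
        have := jw_mul_jw_le hγ hγα (t - a) (x - t)
        rwa [show t - a + (x - t) = x - a by ring] at this
    _ = _ := by
        rw [lintegral_const_mul _ (by fun_prop), lintegral_add_left (by fun_prop),
          lintegral_sub_right_eq_self (fun t => jw (2 * α - γ) t),
          lintegral_sub_left_eq_self (fun t => jw (2 * α - γ) t)]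
        ring

lemma lintegral_rpow_abs_mul_jw_lt_top {a μ : ℝ} (ha : 0 ≤ a) (ha1 : a < 1) (hμ : 0 ≤ μ)
    (h : 1 < a + μ) : ∫⁻ x : ℝ, ENNReal.ofReal (|x| ^ (-a)) * jw μ x < ⊤ := by
  have hloc : IntegrableOn (fun x : ℝ => |x| ^ (-a)) (Metric.ball 0 1) := by
    apply integrableOn_ball_of_norm_le_rpow (C := 1) (α := a) (by simp) (by simpa using ha1)
    · refine Filter.Eventually.of_forall fun x => ?_
      rw [Real.norm_of_nonneg (by positivity), one_mul, Real.norm_eq_abs]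
    · have : Measurable fun x : ℝ => |x| ^ (-a) := by fun_prop
      exact this.aestronglyMeasurable
  have hloc' : ∫⁻ x in Metric.ball (0 : ℝ) 1, ENNReal.ofReal (|x| ^ (-a)) < ⊤ := by
    have := hloc.2
    rw [hasFiniteIntegral_iff_ofReal (Filter.Eventually.of_forall fun x => by positivity)] at this
    exact this
  calc ∫⁻ x : ℝ, ENNReal.ofReal (|x| ^ (-a)) * jw μ x
      ≤ ∫⁻ x : ℝ, ((Metric.ball (0 : ℝ) 1).indicator (fun x => ENNReal.ofReal (|x| ^ (-a))) x +
          ENNReal.ofReal (2 ^ a) * jw (a + μ) x) := by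
        apply lintegral_mono
        intro x
        by_cases hx : x ∈ Metric.ball (0 : ℝ) 1
        · simp only [Set.indicator_of_mem hx]
          refine le_trans ?_ le_self_add
          refine mul_le_of_le_one_right' ?_
          unfold jw
          rw [ENNReal.ofReal_le_one]
          exact Real.rpow_le_one_of_one_le_of_nonpos (by linarith [abs_nonneg x]) (by linarith)
        · simp only [Set.indicator_of_notMem hx, zero_add]
          have hx' : 1 ≤ |x| := by simpa using hx
          unfold jw
          rw [← ENNReal.ofReal_mul (by positivity), ← ENNReal.ofReal_mul (by positivity)]
          apply ENNReal.ofReal_le_ofReal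
          rw [neg_add, Real.rpow_add (by positivity), ← mul_assoc]
          apply mul_le_mul_of_nonneg_right _ (by positivity)
          calc |x| ^ (-a) ≤ ((1 + |x|) / 2) ^ (-a) :=
                Real.rpow_le_rpow_of_nonpos (by positivity) (by linarith) (by linarith)
            _ = _ := by
              rw [Real.div_rpow (by positivity) (by norm_num),
                Real.rpow_neg (by norm_num : (0:ℝ) ≤ 2), div_inv_eq_mul, mul_comm]
    _ < ⊤ := by
        rw [lintegral_add_right _ (by fun_prop), lintegral_indicator Metric.isOpen_ball.measurableSet,
          lintegral_const_mul _ (by fun_prop)]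
        exact ENNReal.add_lt_top.2 ⟨hloc', ENNReal.mul_lt_top ENNReal.ofReal_lt_top
          (lintegral_jw_lt_top h)⟩

lemma lintegral_comp_mul_sub {F : ℝ → ENNReal} (hF : Measurable F) {s : ℝ} (hs : 0 < s) (k : ℝ) :
    ∫⁻ p, F (s * (p - k)) = ENNReal.ofReal s⁻¹ * ∫⁻ r, F r := by
  rw [lintegral_sub_right_eq_self (fun p => F (s * p)) k,
    ← lintegral_map (f := F) (g := fun p => s * p) hF (by fun_prop),
    Real.map_volume_mul_left hs.ne', lintegral_smul_measure, abs_of_pos (inv_pos.2 hs), smul_eq_mul]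

lemma rpow_mul_one_add_rpow_le {θ γ s r R P : ℝ} (hθ : 0 ≤ θ) (hθγ : θ ≤ γ) (hs : 0 < s) (hr : 0 < r)
    (hP : 0 < P) (hrR : r ≤ R) (hPR : P ≤ R) :
    P ^ θ * (1 + s ^ 2 * (r * R)) ^ (-γ) ≤
      2 ^ (γ - θ) * s ^ (-θ) * ((s * r) ^ (-θ) * (1 + s * r) ^ (-(2 * (γ - θ)))) := by
  have hR : 0 < R := by linarith
  have h0 : 0 < 1 + s ^ 2 * (r * R) := by positivity
  have h1 : (1 + s ^ 2 * (r * R)) ^ (-θ) ≤ P ^ (-θ) * (s ^ (-θ) * (s * r) ^ (-θ)) := by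
    rw [← Real.mul_rpow hs.le (by positivity), ← Real.mul_rpow hP.le (by positivity)]
    apply Real.rpow_le_rpow_of_nonpos (by positivity) _ (by linarith)
    have : s ^ 2 * r * P ≤ s ^ 2 * r * R := by gcongr
    nlinarith
  have h2 : (1 + s ^ 2 * (r * R)) ^ (-(γ - θ)) ≤ 2 ^ (γ - θ) * (1 + s * r) ^ (-(2 * (γ - θ))) := by
    have h3 : (1 + s * r) ^ 2 / 2 ≤ 1 + s ^ 2 * (r * R) := by
      have : s ^ 2 * r * r ≤ s ^ 2 * r * R := by gcongr
      nlinarith [sq_nonneg (1 - s * r)]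
    calc (1 + s ^ 2 * (r * R)) ^ (-(γ - θ)) ≤ ((1 + s * r) ^ 2 / 2) ^ (-(γ - θ)) :=
          Real.rpow_le_rpow_of_nonpos (by positivity) h3 (by linarith)
      _ = _ := by
          rw [Real.div_rpow (by positivity) (by norm_num), Real.rpow_neg (by norm_num : (0:ℝ) ≤ 2),
            div_inv_eq_mul, mul_comm, ← Real.rpow_natCast, ← Real.rpow_mul (by positivity)]
          congr 2
          push_cast
          ring
  have hPP : P ^ θ * P ^ (-θ) = 1 := by rw [← Real.rpow_add hP]; simp
  calc P ^ θ * (1 + s ^ 2 * (r * R)) ^ (-γ)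
      = P ^ θ * ((1 + s ^ 2 * (r * R)) ^ (-θ) * (1 + s ^ 2 * (r * R)) ^ (-(γ - θ))) := by
        rw [← Real.rpow_add h0]; ring_nf
    _ ≤ P ^ θ * ((P ^ (-θ) * (s ^ (-θ) * (s * r) ^ (-θ))) *
          (2 ^ (γ - θ) * (1 + s * r) ^ (-(2 * (γ - θ))))) := by gcongr
    _ = (P ^ θ * P ^ (-θ)) * (2 ^ (γ - θ) * s ^ (-θ) * ((s * r) ^ (-θ) *
          (1 + s * r) ^ (-(2 * (γ - θ))))) := by ring
    _ = _ := by rw [hPP, one_mul]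

lemma rpow_mul_jw_quadratic_le {θ γ A : ℝ} (hθ : 0 ≤ θ) (hθγ : θ ≤ γ) (hA : A ≠ 0) (K p : ℝ)
    (h0 : p ≠ 0) (h1 : p ≠ √(K / A)) (h2 : p ≠ -√(K / A)) :
    ENNReal.ofReal (|p| ^ θ) * jw γ (K - A * p ^ 2) ≤
      ENNReal.ofReal (2 ^ (γ - θ) * √|A| ^ (-θ)) *
        (ENNReal.ofReal (|√|A| * (p - √(K / A))| ^ (-θ)) *
            jw (2 * (γ - θ)) (√|A| * (p - √(K / A))) +
          ENNReal.ofReal (|√|A| * (p - -√(K / A))| ^ (-θ)) *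
            jw (2 * (γ - θ)) (√|A| * (p - -√(K / A)))) := by
  set k := √(K / A) with hk
  set s := √|A| with hs
  have hA' : 0 < |A| := abs_pos.2 hA
  have hs0 : 0 < s := Real.sqrt_pos.2 hA'
  have hss : s ^ 2 = |A| := Real.sq_sqrt hA'.le
  have hk0 : 0 ≤ k := Real.sqrt_nonneg _
  have hKA : s ^ 2 * (|p - k| * |p + k|) ≤ |K - A * p ^ 2| := by
    have e : K - A * p ^ 2 = A * (K / A - p ^ 2) := by field_simp
    rw [e, abs_mul, hss, ← abs_mul]
    apply mul_le_mul_of_nonneg_left _ hA'.le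
    rcases le_or_gt 0 (K / A) with h | h
    · rw [← Real.sq_sqrt h, ← hk, abs_sub_comm]
      exact le_of_eq (by ring_nf)
    · have : k = 0 := Real.sqrt_eq_zero_of_nonpos h.le
      rw [this, abs_of_nonneg (by nlinarith [sq_nonneg p]), abs_of_nonpos (by nlinarith [sq_nonneg p])]
      nlinarith
  have hp : 0 < |p| := abs_pos.2 h0
  have key : |p| ^ θ * (1 + s ^ 2 * (|p - k| * |p + k|)) ^ (-γ) ≤
      2 ^ (γ - θ) * s ^ (-θ) * (|s * (p - k)| ^ (-θ) * (1 + |s * (p - k)|) ^ (-(2 * (γ - θ))) +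
        |s * (p - -k)| ^ (-θ) * (1 + |s * (p - -k)|) ^ (-(2 * (γ - θ)))) := by
    rw [mul_add, sub_neg_eq_add, abs_mul s, abs_mul s, abs_of_pos hs0]
    have hr1 : 0 < |p - k| := abs_pos.2 (sub_ne_zero.2 h1)
    have hr2 : 0 < |p + k| := abs_pos.2 (by intro h; exact h2 (by linarith))
    have hn1 : 0 ≤ 2 ^ (γ - θ) * s ^ (-θ) *
      ((s * |p - k|) ^ (-θ) * (1 + s * |p - k|) ^ (-(2 * (γ - θ)))) := by positivity
    have hn2 : 0 ≤ 2 ^ (γ - θ) * s ^ (-θ) *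
      ((s * |p + k|) ^ (-θ) * (1 + s * |p + k|) ^ (-(2 * (γ - θ)))) := by positivity
    rcases le_total 0 p with h | h
    · have hR : |p| ≤ |p + k| := by rw [abs_of_nonneg h, abs_of_nonneg (by linarith)]; linarith
      have hrR : |p - k| ≤ |p + k| := by
        rw [abs_of_nonneg (by linarith : 0 ≤ p + k)]; apply abs_le.2; constructor <;> linarith
      linarith [rpow_mul_one_add_rpow_le hθ hθγ hs0 hr1 hp hrR hR]
    · have hR : |p| ≤ |p - k| := by rw [abs_of_nonpos h, abs_of_nonpos (by linarith)]; linarith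
      have hrR : |p + k| ≤ |p - k| := by
        rw [abs_of_nonpos (by linarith : p - k ≤ 0)]; apply abs_le.2; constructor <;> linarith
      have := rpow_mul_one_add_rpow_le hθ hθγ hs0 hr2 hp hrR hR
      rw [mul_comm |p + k| |p - k|] at this
      linarith
  unfold jw
  rw [← ENNReal.ofReal_mul (by positivity), ← ENNReal.ofReal_mul (by positivity),
    ← ENNReal.ofReal_mul (by positivity), ← ENNReal.ofReal_add (by positivity) (by positivity),
    ← ENNReal.ofReal_mul (by positivity)]
  apply ENNReal.ofReal_le_ofReal
  refine le_trans ?_ key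
  apply mul_le_mul_of_nonneg_left _ (by positivity)
  exact Real.rpow_le_rpow_of_nonpos (by positivity) (by linarith) (by linarith)

lemma exists_lintegral_rpow_mul_jw_quadratic_le {θ γ : ℝ} (hθ : 0 ≤ θ) (hθ1 : θ < 1)
    (h : (1 + θ) / 2 < γ) :
    ∃ C : ENNReal, C ≠ ⊤ ∧ ∀ A : ℝ, A ≠ 0 → ∀ K : ℝ,
      ∫⁻ p, ENNReal.ofReal (|p| ^ θ) * jw γ (K - A * p ^ 2) ≤
        C * ENNReal.ofReal (|A| ^ (-((1 + θ) / 2))) := by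
  have hI := lintegral_rpow_abs_mul_jw_lt_top (a := θ) (μ := 2 * (γ - θ)) hθ hθ1
    (by linarith) (by linarith)
  set I := ∫⁻ x : ℝ, ENNReal.ofReal (|x| ^ (-θ)) * jw (2 * (γ - θ)) x with hIdef
  refine ⟨ENNReal.ofReal (2 ^ (γ - θ)) * (I + I),
    ENNReal.mul_ne_top ENNReal.ofReal_ne_top (ENNReal.add_ne_top.2 ⟨hI.ne, hI.ne⟩), ?_⟩
  intro A hA K
  have hA' : 0 < |A| := abs_pos.2 hA
  have hs0 : 0 < √|A| := Real.sqrt_pos.2 hA'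
  have hmeas : Measurable fun x : ℝ => ENNReal.ofReal (|x| ^ (-θ)) * jw (2 * (γ - θ)) x := by
    fun_prop
  have hae : ∀ᵐ p : ℝ, p ∉ ({0, √(K / A), -√(K / A)} : Set ℝ) :=
    (Set.toFinite _).measure_zero volume |> fun h0 => (compl_mem_ae_iff.2 h0)
  calc ∫⁻ p, ENNReal.ofReal (|p| ^ θ) * jw γ (K - A * p ^ 2)
      ≤ ∫⁻ p, ENNReal.ofReal (2 ^ (γ - θ) * √|A| ^ (-θ)) *
        (ENNReal.ofReal (|√|A| * (p - √(K / A))| ^ (-θ)) *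
            jw (2 * (γ - θ)) (√|A| * (p - √(K / A))) +
          ENNReal.ofReal (|√|A| * (p - -√(K / A))| ^ (-θ)) *
            jw (2 * (γ - θ)) (√|A| * (p - -√(K / A)))) := by
        apply lintegral_mono_ae
        filter_upwards [hae] with p hp
        simp only [Set.mem_insert_iff, Set.mem_singleton_iff, not_or] at hp
        exact rpow_mul_jw_quadratic_le hθ (by linarith) hA K p hp.1 hp.2.1 hp.2.2
    _ = ENNReal.ofReal (2 ^ (γ - θ) * √|A| ^ (-θ)) * (ENNReal.ofReal (√|A|)⁻¹ * I +
          ENNReal.ofReal (√|A|)⁻¹ * I) := by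
        rw [lintegral_const_mul _ (by fun_prop), lintegral_add_left (by fun_prop),
          lintegral_comp_mul_sub hmeas hs0, lintegral_comp_mul_sub hmeas hs0]
    _ = ENNReal.ofReal (2 ^ (γ - θ)) * (I + I) *
          ENNReal.ofReal (√|A| ^ (-θ) * (√|A|)⁻¹) := by
        rw [ENNReal.ofReal_mul (by positivity), ENNReal.ofReal_mul (by positivity)]
        ring
    _ = _ := by
        congr 2
        rw [← Real.rpow_neg_one, ← Real.rpow_add hs0, Real.sqrt_eq_rpow, ← Real.rpow_mul hA'.le]
        ring_nf

lemma lintegral_real_prod {F : ℝ × ℝ → ENNReal} (hF : Measurable F) :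
    ∫⁻ x, F x = ∫⁻ ξ : ℝ, ∫⁻ τ : ℝ, F (τ, ξ) := by
  rw [Measure.volume_eq_prod, lintegral_prod_symm _ hF.aemeasurable]

lemma exists_lintegral_jw_cubic_le {θ γ : ℝ} (hθ : 0 ≤ θ) (hθ1 : θ < 1) (h : (1 + θ) / 2 < γ) :
    ∃ C : ENNReal, C ≠ ⊤ ∧ ∀ η : ℝ, η ≠ 0 → ∀ K : ℝ,
      ∫⁻ ξ, ENNReal.ofReal (|ξ - (η - ξ)| ^ θ) * jw γ (K - ((η - ξ) ^ 3 + ξ ^ 3)) ≤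
        C * ENNReal.ofReal (|η| ^ (-((1 + θ) / 2))) := by
  obtain ⟨C, hC, hq⟩ := exists_lintegral_rpow_mul_jw_quadratic_le hθ hθ1 h
  refine ⟨ENNReal.ofReal (2 ^ θ) * C, ENNReal.mul_ne_top ENNReal.ofReal_ne_top hC, ?_⟩
  intro η hη K
  have hη' : 0 < |η| := abs_pos.2 hη
  calc ∫⁻ ξ, ENNReal.ofReal (|ξ - (η - ξ)| ^ θ) * jw γ (K - ((η - ξ) ^ 3 + ξ ^ 3))
      = ∫⁻ ξ, ENNReal.ofReal (2 ^ θ) * (ENNReal.ofReal (|ξ - η / 2| ^ θ) *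
          jw γ ((K - η ^ 3 / 4) - 3 * η * (ξ - η / 2) ^ 2)) := by
        apply lintegral_congr
        intro ξ
        rw [← mul_assoc, ← ENNReal.ofReal_mul (by positivity),
          ← Real.mul_rpow (by norm_num) (by positivity)]
        have e1 : |ξ - (η - ξ)| = 2 * |ξ - η / 2| := by
          rw [← abs_of_pos (by norm_num : (0:ℝ) < 2), ← abs_mul, abs_of_pos (by norm_num : (0:ℝ) < 2)]
          ring_nf
        have e2 : K - ((η - ξ) ^ 3 + ξ ^ 3) = (K - η ^ 3 / 4) - 3 * η * (ξ - η / 2) ^ 2 := by ring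
        rw [e1, e2]
    _ = ENNReal.ofReal (2 ^ θ) * ∫⁻ p, (ENNReal.ofReal (|p| ^ θ) *
          jw γ ((K - η ^ 3 / 4) - 3 * η * p ^ 2)) := by
        rw [lintegral_const_mul _ (by fun_prop)]
        rw [lintegral_sub_right_eq_self (fun p => ENNReal.ofReal (|p| ^ θ) *
          jw γ ((K - η ^ 3 / 4) - 3 * η * p ^ 2))]
    _ ≤ ENNReal.ofReal (2 ^ θ) * (C * ENNReal.ofReal (|3 * η| ^ (-((1 + θ) / 2)))) := by
        gcongr
        exact hq _ (by positivity) _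
    _ ≤ _ := by
        rw [mul_assoc]
        refine mul_le_mul' le_rfl (mul_le_mul' le_rfl (ENNReal.ofReal_le_ofReal ?_))
        refine Real.rpow_le_rpow_of_nonpos hη' ?_ (by linarith)
        rw [abs_mul, abs_of_pos (by norm_num : (0:ℝ) < 3)]
        linarith

/-- The modulation `τ - ξ³` of a space-time frequency `(τ, ξ)`. -/
def airyMod (x : ℝ × ℝ) : ℝ := x.1 - x.2 ^ 3

@[fun_prop]
lemma measurable_airyMod : Measurable airyMod := by
  unfold airyMod; fun_prop

/-- The kernel controlling products of two factors with transversal frequencies. -/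
def pairKernel (α θ : ℝ) (x y : ℝ × ℝ) : ENNReal :=
  jw α (airyMod x) * jw α (airyMod y) *
    ENNReal.ofReal (|x.2 - y.2| ^ θ * |x.2 + y.2| ^ ((1 + θ) / 2))

/-- The kernel controlling products of three factors. -/
def tripleKernel (α θ : ℝ) (g : ℝ × ℝ → ENNReal) (x y z : ℝ × ℝ) : ENNReal :=
  jw α (airyMod x) * jw α (airyMod y) * jw α (airyMod z) *
    (ENNReal.ofReal (|x.2 - y.2| ^ θ) * g (x.2 + y.2 + z.2, x.2 + y.2))

lemma measurable_pairKernel (α θ : ℝ) :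
    Measurable fun p : (ℝ × ℝ) × (ℝ × ℝ) => pairKernel α θ p.1 p.2 := by
  unfold pairKernel; fun_prop

lemma measurable_tripleKernel (α θ : ℝ) {g : ℝ × ℝ → ENNReal} (hg : Measurable g) :
    Measurable fun p : (ℝ × ℝ) × (ℝ × ℝ) × (ℝ × ℝ) => tripleKernel α θ g p.1 p.2.1 p.2.2 := by
  unfold tripleKernel; fun_prop

lemma exists_lintegral_pairKernel_le {α γ θ : ℝ} (hγα : γ ≤ α) (hαγ : 1 < 2 * α - γ)
    (hθ : 0 ≤ θ) (hθ1 : θ < 1) (h : (1 + θ) / 2 < γ) :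
    ∃ C : ENNReal, C ≠ ⊤ ∧ ∀ X : ℝ × ℝ, ∫⁻ x, pairKernel α θ x (X - x) ≤ C := by
  obtain ⟨C₁, hC₁, hconv⟩ := exists_lintegral_jw_mul_jw_le (by linarith) hγα hαγ
  obtain ⟨C₂, hC₂, hcub⟩ := exists_lintegral_jw_cubic_le hθ hθ1 h
  refine ⟨C₁ * C₂, ENNReal.mul_ne_top hC₁ hC₂, ?_⟩
  rintro ⟨T, Ξ⟩
  have hm : Measurable fun x : ℝ × ℝ => pairKernel α θ x ((T, Ξ) - x) := by
    unfold pairKernel; fun_prop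
  rw [lintegral_real_prod hm]
  by_cases hΞ : Ξ = 0
  · have : ∀ x y : ℝ, pairKernel α θ (y, x) ((T, Ξ) - (y, x)) = 0 := by
      intro x y
      simp only [pairKernel, Prod.mk_sub_mk, hΞ]
      rw [show x + (0 - x) = 0 by ring, abs_zero, Real.zero_rpow (by positivity)]
      simp
    simp_rw [this]
    simp
  calc ∫⁻ ξ, ∫⁻ τ, pairKernel α θ (τ, ξ) ((T, Ξ) - (τ, ξ))
      ≤ ∫⁻ ξ, C₁ * ENNReal.ofReal (|Ξ| ^ ((1 + θ) / 2)) *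
          (ENNReal.ofReal (|ξ - (Ξ - ξ)| ^ θ) * jw γ (T - ((Ξ - ξ) ^ 3 + ξ ^ 3))) := by
        apply lintegral_mono
        intro ξ
        simp only [pairKernel, airyMod, Prod.mk_sub_mk]
        rw [lintegral_mul_const _ (by fun_prop), show ξ + (Ξ - ξ) = Ξ by ring,
          ENNReal.ofReal_mul (by positivity)]
        have := hconv (T - (Ξ - ξ) ^ 3) (ξ ^ 3)
        calc _ = (∫⁻ t, jw α (t - ξ ^ 3) * jw α (T - (Ξ - ξ) ^ 3 - t)) *
              (ENNReal.ofReal (|ξ - (Ξ - ξ)| ^ θ) * ENNReal.ofReal (|Ξ| ^ ((1 + θ) / 2))) := by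
              congr 1
              apply lintegral_congr
              intro t
              rw [show T - t - (Ξ - ξ) ^ 3 = T - (Ξ - ξ) ^ 3 - t by ring]
          _ ≤ _ := mul_le_mul_left this _
          _ = _ := by
              rw [show T - (Ξ - ξ) ^ 3 - ξ ^ 3 = T - ((Ξ - ξ) ^ 3 + ξ ^ 3) by ring]; ring
    _ ≤ C₁ * ENNReal.ofReal (|Ξ| ^ ((1 + θ) / 2)) *
          (C₂ * ENNReal.ofReal (|Ξ| ^ (-((1 + θ) / 2)))) := by
        rw [lintegral_const_mul _ (by fun_prop)]
        gcongr
        exact hcub Ξ hΞ T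
    _ = C₁ * C₂ * ENNReal.ofReal (|Ξ| ^ ((1 + θ) / 2) * |Ξ| ^ (-((1 + θ) / 2))) := by
        rw [ENNReal.ofReal_mul (by positivity)]; ring
    _ = C₁ * C₂ := by
        rw [← Real.rpow_add (abs_pos.2 hΞ)]; simp

lemma exists_lintegral_tripleKernel_le {α β γ θ : ℝ} (hβα : β ≤ α) (hαβ : 1 < 2 * α - β)
    (hγβ : γ ≤ β) (hβγ : 1 < 2 * β - γ) (hθ : 0 ≤ θ) (hθ1 : θ < 1) (h : (1 + θ) / 2 < γ)
    {g : ℝ × ℝ → ENNReal} (hg : Measurable g) {Cg : ENNReal} (hCg : Cg ≠ ⊤)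
    (hgC : ∀ Ξ : ℝ, ∫⁻ η, ENNReal.ofReal (|η| ^ (-((1 + θ) / 2))) * g (Ξ, η) ≤ Cg) :
    ∃ C : ENNReal, C ≠ ⊤ ∧ ∀ X : ℝ × ℝ,
      ∫⁻ x, ∫⁻ y, tripleKernel α θ g x y (X - (x + y)) ≤ C := by
  obtain ⟨C₁, hC₁, hconv₁⟩ := exists_lintegral_jw_mul_jw_le (by linarith) hβα hαβ
  obtain ⟨C₂, hC₂, hconv₂⟩ := exists_lintegral_jw_mul_jw_le (by linarith) hγβ hβγ
  obtain ⟨C₃, hC₃, hcub⟩ := exists_lintegral_jw_cubic_le hθ hθ1 h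
  refine ⟨C₁ * C₂ * C₃ * Cg,
    ENNReal.mul_ne_top (ENNReal.mul_ne_top (ENNReal.mul_ne_top hC₁ hC₂) hC₃) hCg, ?_⟩
  rintro ⟨T, Ξ⟩
  have hm4 : Measurable fun q : (ℝ × ℝ) × (ℝ × ℝ) =>
      tripleKernel α θ g q.2 (q.1 - q.2) ((T, Ξ) - q.1) := by
    unfold tripleKernel; fun_prop
  have hshift : ∀ x : ℝ × ℝ, ∫⁻ y, tripleKernel α θ g x y ((T, Ξ) - (x + y)) =
      ∫⁻ Y, tripleKernel α θ g x (Y - x) ((T, Ξ) - Y) := by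
    intro x
    rw [← lintegral_sub_right_eq_self (fun y => tripleKernel α θ g x y ((T, Ξ) - (x + y))) x]
    simp
  simp_rw [hshift]
  rw [lintegral_lintegral_swap (by exact (hm4.comp measurable_swap).aemeasurable)]
  have hpoint : ∀ η ξ : ℝ, ∫⁻ t, ∫⁻ τ, tripleKernel α θ g (τ, ξ) ((t, η) - (τ, ξ)) ((T, Ξ) - (t, η)) ≤
      C₁ * C₂ * g (Ξ, η) * (ENNReal.ofReal (|ξ - (η - ξ)| ^ θ) *
        jw γ (T - (Ξ - η) ^ 3 - ((η - ξ) ^ 3 + ξ ^ 3))) := by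
    intro η ξ
    have e : ∀ t τ : ℝ, tripleKernel α θ g (τ, ξ) ((t, η) - (τ, ξ)) ((T, Ξ) - (t, η)) =
        (jw α (τ - ξ ^ 3) * jw α (t - (η - ξ) ^ 3 - τ)) *
          (jw α (T - (Ξ - η) ^ 3 - t) * (ENNReal.ofReal (|ξ - (η - ξ)| ^ θ) * g (Ξ, η))) := by
      intro t τ
      simp only [tripleKernel, airyMod, Prod.mk_sub_mk]
      rw [show t - τ - (η - ξ) ^ 3 = t - (η - ξ) ^ 3 - τ by ring,
        show T - t - (Ξ - η) ^ 3 = T - (Ξ - η) ^ 3 - t by ring,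
        show ξ + (η - ξ) + (Ξ - η) = Ξ by ring, show ξ + (η - ξ) = η by ring]
      ring
    simp_rw [e]
    calc _ ≤ ∫⁻ t, C₁ * (ENNReal.ofReal (|ξ - (η - ξ)| ^ θ) * g (Ξ, η)) *
          (jw β (t - ((η - ξ) ^ 3 + ξ ^ 3)) * jw β (T - (Ξ - η) ^ 3 - t)) := by
          apply lintegral_mono
          intro t
          simp only
          rw [lintegral_mul_const _ (by fun_prop)]
          calc _ ≤ (C₁ * jw β (t - (η - ξ) ^ 3 - ξ ^ 3)) * (jw β (T - (Ξ - η) ^ 3 - t) *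
                (ENNReal.ofReal (|ξ - (η - ξ)| ^ θ) * g (Ξ, η))) := by
                gcongr
                · exact hconv₁ _ _
                · exact jw_anti hβα _
            _ = _ := by
                rw [show t - (η - ξ) ^ 3 - ξ ^ 3 = t - ((η - ξ) ^ 3 + ξ ^ 3) by ring]; ring
      _ ≤ C₁ * (ENNReal.ofReal (|ξ - (η - ξ)| ^ θ) * g (Ξ, η)) *
          (C₂ * jw γ (T - (Ξ - η) ^ 3 - ((η - ξ) ^ 3 + ξ ^ 3))) := by
          rw [lintegral_const_mul _ (by fun_prop)]
          gcongr
          exact hconv₂ _ _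
      _ = _ := by ring
  have hne : ∀ᵐ η : ℝ, η ≠ 0 := by
    simp [ae_iff]
  have hmY : Measurable fun Y : ℝ × ℝ => ∫⁻ x, tripleKernel α θ g x (Y - x) ((T, Ξ) - Y) :=
    hm4.lintegral_prod_right'
  calc ∫⁻ Y, ∫⁻ x, tripleKernel α θ g x (Y - x) ((T, Ξ) - Y)
      = ∫⁻ η, ∫⁻ t, ∫⁻ x, tripleKernel α θ g x ((t, η) - x) ((T, Ξ) - (t, η)) := by
        rw [lintegral_real_prod hmY]
    _ = ∫⁻ η, ∫⁻ t, ∫⁻ ξ, ∫⁻ τ,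
          tripleKernel α θ g (τ, ξ) ((t, η) - (τ, ξ)) ((T, Ξ) - (t, η)) := by
        apply lintegral_congr; intro η
        apply lintegral_congr; intro t
        rw [lintegral_real_prod]
        unfold tripleKernel
        fun_prop
    _ = ∫⁻ η, ∫⁻ ξ, ∫⁻ t, ∫⁻ τ,
          tripleKernel α θ g (τ, ξ) ((t, η) - (τ, ξ)) ((T, Ξ) - (t, η)) := by
        apply lintegral_congr; intro η
        rw [lintegral_lintegral_swap]
        have : Measurable fun q : (ℝ × ℝ) × ℝ =>
            tripleKernel α θ g (q.2, q.1.2) ((q.1.1, η) - (q.2, q.1.2)) ((T, Ξ) - (q.1.1, η)) := by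
          unfold tripleKernel; fun_prop
        exact this.lintegral_prod_right'.aemeasurable
    _ ≤ ∫⁻ η, ∫⁻ ξ, C₁ * C₂ * g (Ξ, η) * (ENNReal.ofReal (|ξ - (η - ξ)| ^ θ) *
        jw γ (T - (Ξ - η) ^ 3 - ((η - ξ) ^ 3 + ξ ^ 3))) :=
        lintegral_mono fun η => lintegral_mono fun ξ => hpoint η ξ
    _ ≤ ∫⁻ η, C₁ * C₂ * C₃ * (ENNReal.ofReal (|η| ^ (-((1 + θ) / 2))) * g (Ξ, η)) := by
        apply lintegral_mono_ae
        filter_upwards [hne] with η hη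
        rw [lintegral_const_mul _ (by fun_prop)]
        calc _ ≤ C₁ * C₂ * g (Ξ, η) * (C₃ * ENNReal.ofReal (|η| ^ (-((1 + θ) / 2)))) := by
              gcongr
              exact hcub η hη _
          _ = _ := by ring
    _ ≤ _ := by
        rw [lintegral_const_mul _ (by fun_prop)]
        gcongr
        exact hgC Ξ

/-- The weight in the third frequency used with `tripleKernel`. -/
def tripleWeight (θ μ ν : ℝ) (p : ℝ × ℝ) : ENNReal :=
  jw μ p.2 + ENNReal.ofReal (|p.2| ^ ((1 + θ) / 2)) *
    (ENNReal.ofReal (|2 * p.1 / 3 - p.2| ^ (-θ)) * jw ν (2 * p.1 / 3 - p.2))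

@[fun_prop]
lemma measurable_tripleWeight (θ μ ν : ℝ) : Measurable (tripleWeight θ μ ν) := by
  unfold tripleWeight; fun_prop

lemma exists_lintegral_tripleWeight_le {θ μ ν : ℝ} (hθ : 0 ≤ θ) (hθ1 : θ < 1) (hμ : 0 ≤ μ)
    (hν : 0 ≤ ν) (h1 : 1 < (1 + θ) / 2 + μ) (h2 : 1 < θ + ν) :
    ∃ C : ENNReal, C ≠ ⊤ ∧ ∀ Ξ : ℝ,
      ∫⁻ η, ENNReal.ofReal (|η| ^ (-((1 + θ) / 2))) * tripleWeight θ μ ν (Ξ, η) ≤ C := by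
  have hI := lintegral_rpow_abs_mul_jw_lt_top (a := (1 + θ) / 2) (by linarith) (by linarith) hμ h1
  have hJ := lintegral_rpow_abs_mul_jw_lt_top (a := θ) hθ hθ1 hν h2
  refine ⟨_, ENNReal.add_ne_top.2 ⟨hI.ne, hJ.ne⟩, ?_⟩
  intro Ξ
  calc ∫⁻ η, ENNReal.ofReal (|η| ^ (-((1 + θ) / 2))) * tripleWeight θ μ ν (Ξ, η)
      ≤ ∫⁻ η, (ENNReal.ofReal (|η| ^ (-((1 + θ) / 2))) * jw μ η +
          ENNReal.ofReal (|2 * Ξ / 3 - η| ^ (-θ)) * jw ν (2 * Ξ / 3 - η)) := by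
        apply lintegral_mono
        intro η
        simp only [tripleWeight]
        rw [mul_add]
        refine add_le_add le_rfl ?_
        rw [← mul_assoc, ← ENNReal.ofReal_mul (by positivity)]
        refine mul_le_of_le_one_left' ?_
        rw [ENNReal.ofReal_le_one]
        by_cases hη : η = 0
        · simp [hη, Real.zero_rpow (by linarith : (1 + θ) / 2 ≠ 0)]
        · rw [← Real.rpow_add (abs_pos.2 hη)]; simp
    _ = _ := by
        rw [lintegral_add_left (by fun_prop),
          lintegral_sub_left_eq_self (fun η => ENNReal.ofReal (|η| ^ (-θ)) * jw ν η)]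

/-- The point of the hyperplane `x₀ + ⋯ + x₄ = 0` with last four coordinates `q`. -/
def hyperplaneLift (q : Fin 4 → ℝ × ℝ) : Fin 5 → ℝ × ℝ := Fin.cons (-∑ i, q i) q

@[fun_prop]
lemma measurable_hyperplaneLift : Measurable hyperplaneLift := by
  refine measurable_pi_lambda _ fun i => ?_
  refine Fin.cases ?_ (fun j => ?_) i
  · simp only [hyperplaneLift, Fin.cons_zero]; fun_prop
  · simp only [hyperplaneLift, Fin.cons_succ]; fun_prop

lemma sum_hyperplaneLift (q : Fin 4 → ℝ × ℝ) : ∑ i, hyperplaneLift q i = 0 := by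
  simp [hyperplaneLift, Fin.sum_univ_succ]

/-- Integration over the hyperplane `x₀ + ⋯ + x₄ = 0`. -/
def hyperplaneIntegral (F : (Fin 5 → ℝ × ℝ) → ENNReal) : ENNReal :=
  ∫⁻ q, F (hyperplaneLift q)

lemma lintegral_update_neg_sum {G : (Fin 4 → ℝ × ℝ) → ENNReal} (hG : Measurable G) (j : Fin 4) :
    ∫⁻ q, G (Function.update q j (-∑ i, q i)) = ∫⁻ q, G q := by
  have hmp := (volume_preserving_piFinSuccAbove (fun _ : Fin 4 => ℝ × ℝ) j).symm
  have hup : Measurable fun q : Fin 4 → ℝ × ℝ => Function.update q j (-∑ i, q i) := by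
    refine measurable_pi_lambda _ fun i => ?_
    by_cases h : i = j
    · subst h; simp only [Function.update_self]; fun_prop
    · simp only [Function.update_of_ne h]; fun_prop
  have hins : ∀ a r, (MeasurableEquiv.piFinSuccAbove (fun _ : Fin 4 => ℝ × ℝ) j).symm (a, r) =
      j.insertNth a r := fun a r => rfl
  have hG' : Measurable fun q => G (Function.update q j (-∑ i, q i)) := hG.comp hup
  rw [← hmp.lintegral_comp hG, ← hmp.lintegral_comp hG', Measure.volume_eq_prod,
    lintegral_prod_symm _ (by exact (hG'.comp hmp.measurable).aemeasurable),
    lintegral_prod_symm _ (by exact (hG.comp hmp.measurable).aemeasurable)]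
  apply lintegral_congr
  intro r
  simp only [hins, Fin.sum_univ_succAbove _ j, Fin.insertNth_apply_same,
    Fin.insertNth_apply_succAbove, Fin.update_insertNth]
  rw [← lintegral_sub_left_eq_self (fun a => G (j.insertNth a r)) (-∑ i, r i)]
  apply lintegral_congr
  intro a
  congr 2
  abel

lemma hyperplaneLift_comp_swap (q : Fin 4 → ℝ × ℝ) (j : Fin 4) :
    hyperplaneLift q ∘ Equiv.swap 0 j.succ = hyperplaneLift (Function.update q j (-∑ i, q i)) := by
  have hsum : -∑ i, Function.update q j (-∑ i, q i) i = q j := by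
    rw [Finset.sum_update_of_mem (Finset.mem_univ j), ← Finset.add_sum_erase _ q (Finset.mem_univ j),
      Finset.sdiff_singleton_eq_erase]
    abel
  ext1 i
  simp only [Function.comp, hyperplaneLift, hsum]
  refine Fin.cases ?_ (fun k => ?_) i
  · simp
  · by_cases h : k = j
    · subst h; simp
    · rw [Equiv.swap_apply_of_ne_of_ne (Fin.succ_ne_zero k) (by simpa using h)]
      simp [Function.update_of_ne h]

lemma hyperplaneIntegral_comp_swap_zero {F : (Fin 5 → ℝ × ℝ) → ENNReal} (hF : Measurable F)
    (j : Fin 4) : hyperplaneIntegral (fun x => F (x ∘ Equiv.swap 0 j.succ)) = hyperplaneIntegral F := by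
  unfold hyperplaneIntegral
  simp_rw [hyperplaneLift_comp_swap]
  exact lintegral_update_neg_sum (hF.comp measurable_hyperplaneLift) j

lemma measurable_comp_perm {F : (Fin 5 → ℝ × ℝ) → ENNReal} (hF : Measurable F)
    (σ : Equiv.Perm (Fin 5)) : Measurable fun x : Fin 5 → ℝ × ℝ => F (x ∘ σ) :=
  hF.comp (measurable_pi_lambda _ fun i => measurable_pi_apply (σ i))

lemma hyperplaneIntegral_comp_perm (σ : Equiv.Perm (Fin 5)) :
    ∀ F : (Fin 5 → ℝ × ℝ) → ENNReal, Measurable F →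
      hyperplaneIntegral (fun x => F (x ∘ σ)) = hyperplaneIntegral F := by
  have hmul : ∀ σ τ : Equiv.Perm (Fin 5),
      (∀ F : (Fin 5 → ℝ × ℝ) → ENNReal, Measurable F →
        hyperplaneIntegral (fun x => F (x ∘ σ)) = hyperplaneIntegral F) →
      (∀ F : (Fin 5 → ℝ × ℝ) → ENNReal, Measurable F →
        hyperplaneIntegral (fun x => F (x ∘ τ)) = hyperplaneIntegral F) →
      (∀ F : (Fin 5 → ℝ × ℝ) → ENNReal, Measurable F →
        hyperplaneIntegral (fun x => F (x ∘ (σ * τ : Equiv.Perm (Fin 5)))) =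
          hyperplaneIntegral F) := by
    intro σ τ hσ hτ F hF
    rw [← hτ F hF, ← hσ _ (measurable_comp_perm hF τ)]
    rfl
  have hzero : ∀ j : Fin 5, j ≠ 0 → ∀ F : (Fin 5 → ℝ × ℝ) → ENNReal, Measurable F →
      hyperplaneIntegral (fun x => F (x ∘ Equiv.swap 0 j)) = hyperplaneIntegral F := by
    intro j hj F hF
    obtain ⟨k, rfl⟩ := Fin.exists_succ_eq.2 hj
    exact hyperplaneIntegral_comp_swap_zero hF k
  induction σ using Equiv.Perm.swap_induction_on with
  | one => intro F _; rfl
  | swap_mul f x y hxy ih =>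
    refine hmul _ _ ?_ ih
    by_cases hx : x = 0
    · subst hx; exact hzero y (Ne.symm hxy)
    by_cases hy : y = 0
    · subst hy; rw [Equiv.swap_comm]; exact hzero x hx
    rw [← Equiv.swap_mul_swap_mul_swap (x := y) (y := 0) (z := x) hy hxy.symm, Equiv.swap_comm y 0]
    exact hmul _ _ (hmul _ _ (hzero x hx) (hzero y hy)) (hzero x hx)

lemma lintegral_fin_succ {n : ℕ} {F : (Fin (n + 1) → ℝ × ℝ) → ENNReal} (hF : Measurable F) :
    ∫⁻ q, F q = ∫⁻ a, ∫⁻ r : Fin n → ℝ × ℝ, F (Fin.cons a r) := by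
  have hmp := (volume_preserving_piFinSuccAbove (fun _ : Fin (n + 1) => ℝ × ℝ) 0).symm
  rw [← hmp.lintegral_comp hF, Measure.volume_eq_prod,
    lintegral_prod _ (by exact (hF.comp hmp.measurable).aemeasurable)]
  have hins : ∀ a r, (MeasurableEquiv.piFinSuccAbove (fun _ : Fin (n + 1) => ℝ × ℝ) 0).symm (a, r) =
      Fin.cons a r := fun a r => Fin.insertNth_zero' a r
  simp only [hins]

lemma measurable_cons {n : ℕ} (a : ℝ × ℝ) :
    Measurable fun r : Fin n → ℝ × ℝ => (Fin.cons a r : Fin (n + 1) → ℝ × ℝ) := by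
  refine measurable_pi_lambda _ fun i => ?_
  refine Fin.cases ?_ (fun j => ?_) i
  · simp only [Fin.cons_zero]; fun_prop
  · simp only [Fin.cons_succ]; fun_prop

lemma lintegral_fin_four {F : (Fin 4 → ℝ × ℝ) → ENNReal} (hF : Measurable F) :
    ∫⁻ q, F q = ∫⁻ a, ∫⁻ b, ∫⁻ c, ∫⁻ d, F ![a, b, c, d] := by
  rw [lintegral_fin_succ hF]
  apply lintegral_congr; intro a
  have h1 : Measurable fun r : Fin 3 → ℝ × ℝ => F (Fin.cons a r) := hF.comp (measurable_cons a)
  rw [lintegral_fin_succ h1]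
  apply lintegral_congr; intro b
  have h2 : Measurable fun r : Fin 2 → ℝ × ℝ => F (Fin.cons a (Fin.cons b r)) :=
    h1.comp (measurable_cons b)
  rw [lintegral_fin_succ h2]
  apply lintegral_congr; intro c
  have h3 : Measurable fun r : Fin 1 → ℝ × ℝ => F (Fin.cons a (Fin.cons b (Fin.cons c r))) :=
    h2.comp (measurable_cons c)
  rw [lintegral_fin_succ h3]
  apply lintegral_congr; intro d
  rw [lintegral_unique]
  simp only [Measure.volume_pi_eq_dirac ![], measure_univ, mul_one]
  rfl

lemma hyperplaneIntegral_eq {F : (Fin 5 → ℝ × ℝ) → ENNReal} (hF : Measurable F) :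
    hyperplaneIntegral F =
      ∫⁻ a, ∫⁻ b, ∫⁻ c, ∫⁻ d, F ![-(a + b + c + d), a, b, c, d] := by
  unfold hyperplaneIntegral
  rw [lintegral_fin_four (by exact hF.comp measurable_hyperplaneLift)]
  simp only [hyperplaneLift, Fin.sum_univ_four]
  rfl

lemma hyperplaneIntegral_mul_pair_le {k : ℝ × ℝ → ℝ × ℝ → ENNReal}
    (hk : Measurable fun p : (ℝ × ℝ) × (ℝ × ℝ) => k p.1 p.2) {C : ENNReal}
    (hC : ∀ X, ∫⁻ x, k x (X - x) ≤ C) {f g h : ℝ × ℝ → ENNReal} (hf : Measurable f)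
    (hg : Measurable g) (hh : Measurable h) :
    hyperplaneIntegral (fun x => f (x 2) * g (x 3) * h (x 4) * k (x 0) (x 1)) ≤
      (∫⁻ x, f x) * ((∫⁻ x, g x) * ((∫⁻ x, h x) * C)) := by
  have hF : Measurable fun x : Fin 5 → ℝ × ℝ => f (x 2) * g (x 3) * h (x 4) * k (x 0) (x 1) := by
    have : Measurable fun x : Fin 5 → ℝ × ℝ => k (x 0) (x 1) :=
      Measurable.comp (f := fun x : Fin 5 → ℝ × ℝ => (x 0, x 1)) hk (by fun_prop)
    fun_prop
  rw [← hyperplaneIntegral_comp_perm (finRotate 5)⁻¹ _ hF,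
    hyperplaneIntegral_eq (measurable_comp_perm hF _)]
  have h0 : (finRotate 5)⁻¹ 0 = 4 := by decide
  have h1 : (finRotate 5)⁻¹ 1 = 0 := by decide
  have h2 : (finRotate 5)⁻¹ 2 = 1 := by decide
  have h3 : (finRotate 5)⁻¹ 3 = 2 := by decide
  have h4 : (finRotate 5)⁻¹ 4 = 3 := by decide
  simp only [Function.comp, h0, h1, h2, h3, h4]
  calc _ ≤ ∫⁻ a, ∫⁻ b, ∫⁻ c, f a * (g b * (h c * C)) := by
        refine lintegral_mono fun a => lintegral_mono fun b => lintegral_mono fun c => ?_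
        have hm : Measurable fun d => k d (-(a + b + c) - d) :=
          hk.comp (measurable_id.prodMk (measurable_id.const_sub _))
        calc _ = ∫⁻ d, f a * (g b * h c) * k d (-(a + b + c) - d) := by
              refine lintegral_congr fun d => ?_
              have : -(a + b + c + d) = -(a + b + c) - d := by abel
              simp [this, Matrix.cons_val, mul_assoc]
          _ = f a * (g b * h c) * ∫⁻ d, k d (-(a + b + c) - d) := lintegral_const_mul _ hm
          _ ≤ f a * (g b * h c) * C := by gcongr; exact hC _
          _ = _ := by ring
    _ = _ := by
        have e1 : ∀ a b, ∫⁻ c, f a * (g b * (h c * C)) = f a * (g b * ((∫⁻ c, h c) * C)) := by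
          intro a b
          rw [lintegral_const_mul _ (by fun_prop), lintegral_const_mul _ (by fun_prop),
            lintegral_mul_const _ hh]
        have e2 : ∀ a, ∫⁻ b, f a * (g b * ((∫⁻ c, h c) * C)) =
            f a * ((∫⁻ b, g b) * ((∫⁻ c, h c) * C)) := by
          intro a
          rw [lintegral_const_mul _ (by fun_prop), lintegral_mul_const _ hg]
        simp only [e1, e2]
        rw [lintegral_mul_const _ hf]

lemma hyperplaneIntegral_mul_triple_le {k : ℝ × ℝ → ℝ × ℝ → ℝ × ℝ → ENNReal}
    (hk : Measurable fun p : (ℝ × ℝ) × (ℝ × ℝ) × (ℝ × ℝ) => k p.1 p.2.1 p.2.2) {C : ENNReal}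
    (hC : ∀ X, ∫⁻ x, ∫⁻ y, k x y (X - (x + y)) ≤ C) {f g : ℝ × ℝ → ENNReal} (hf : Measurable f)
    (hg : Measurable g) :
    hyperplaneIntegral (fun x => f (x 0) * g (x 1) * k (x 2) (x 3) (x 4)) ≤
      (∫⁻ x, f x) * ((∫⁻ x, g x) * C) := by
  have hF : Measurable fun x : Fin 5 → ℝ × ℝ => f (x 0) * g (x 1) * k (x 2) (x 3) (x 4) := by
    have : Measurable fun x : Fin 5 → ℝ × ℝ => k (x 2) (x 3) (x 4) :=
      Measurable.comp (f := fun x : Fin 5 → ℝ × ℝ => (x 2, x 3, x 4)) hk (by fun_prop)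
    fun_prop
  rw [← hyperplaneIntegral_comp_perm (finRotate 5) _ hF,
    hyperplaneIntegral_eq (measurable_comp_perm hF _)]
  have h0 : finRotate 5 0 = 1 := by decide
  have h1 : finRotate 5 1 = 2 := by decide
  have h2 : finRotate 5 2 = 3 := by decide
  have h3 : finRotate 5 3 = 4 := by decide
  have h4 : finRotate 5 4 = 0 := by decide
  simp only [Function.comp, h0, h1, h2, h3, h4]
  calc _ ≤ ∫⁻ a, ∫⁻ b, f a * (g b * C) := by
        refine lintegral_mono fun a => lintegral_mono fun b => ?_
        have hm : Measurable fun p : (ℝ × ℝ) × (ℝ × ℝ) => k p.1 p.2 (-(a + b) - (p.1 + p.2)) :=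
          hk.comp (measurable_fst.prodMk (measurable_snd.prodMk (by fun_prop)))
        calc _ = ∫⁻ c, f a * g b * ∫⁻ d, k c d (-(a + b) - (c + d)) := by
              refine lintegral_congr fun c => ?_
              rw [← lintegral_const_mul _ (by exact hm.comp measurable_prodMk_left)]
              refine lintegral_congr fun d => ?_
              have : -(a + b + c + d) = -(a + b) - (c + d) := by abel
              simp [this, Matrix.cons_val]
          _ = f a * g b * ∫⁻ c, ∫⁻ d, k c d (-(a + b) - (c + d)) :=
              lintegral_const_mul _ hm.lintegral_prod_right'
          _ ≤ f a * g b * C := by gcongr; exact hC _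
          _ = _ := by ring
    _ = _ := by
        have e : ∀ a, ∫⁻ b, f a * (g b * C) = f a * ((∫⁻ b, g b) * C) := by
          intro a
          rw [lintegral_const_mul _ (by fun_prop), lintegral_mul_const _ hg]
        simp only [e]
        rw [lintegral_mul_const _ hf]

lemma hyperplaneIntegral_sqrt_mul_le {kp : ℝ × ℝ → ℝ × ℝ → ENNReal}
    (hkp : Measurable fun p : (ℝ × ℝ) × (ℝ × ℝ) => kp p.1 p.2) {Cp : ENNReal}
    (hCp : ∀ X, ∫⁻ x, kp x (X - x) ≤ Cp) {kt : ℝ × ℝ → ℝ × ℝ → ℝ × ℝ → ENNReal}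
    (hkt : Measurable fun p : (ℝ × ℝ) × (ℝ × ℝ) × (ℝ × ℝ) => kt p.1 p.2.1 p.2.2) {Ct : ENNReal}
    (hCt : ∀ X, ∫⁻ x, ∫⁻ y, kt x y (X - (x + y)) ≤ Ct) {f : Fin 5 → ℝ × ℝ → ENNReal}
    (hf : ∀ i, Measurable (f i)) :
    hyperplaneIntegral (fun x => (kp (x 0) (x 1) * kt (x 2) (x 3) (x 4)) ^ (1 / 2 : ℝ) *
        ∏ i, f i (x i)) ≤ (Ct * Cp) ^ (1 / 2 : ℝ) * ∏ i, (∫⁻ x, f i x ^ 2) ^ (1 / 2 : ℝ) := by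
  have hmp : Measurable fun x : Fin 5 → ℝ × ℝ => kp (x 0) (x 1) :=
    Measurable.comp (f := fun x : Fin 5 → ℝ × ℝ => (x 0, x 1)) hkp (by fun_prop)
  have hmt : Measurable fun x : Fin 5 → ℝ × ℝ => kt (x 2) (x 3) (x 4) :=
    Measurable.comp (f := fun x : Fin 5 → ℝ × ℝ => (x 2, x 3, x 4)) hkt (by fun_prop)
  have hA := hyperplaneIntegral_mul_triple_le hkt hCt ((hf 0).pow_const 2) ((hf 1).pow_const 2)
  have hB := hyperplaneIntegral_mul_pair_le hkp hCp ((hf 2).pow_const 2) ((hf 3).pow_const 2)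
    ((hf 4).pow_const 2)
  have hsq : ∀ a b : ENNReal, (a * b ^ (1 / 2 : ℝ)) ^ (2 : ℝ) = a ^ 2 * b := by
    intro a b
    rw [ENNReal.mul_rpow_of_nonneg _ _ (by norm_num), ← ENNReal.rpow_mul]
    norm_num
  unfold hyperplaneIntegral at *
  have hF : Measurable fun q => f 0 (hyperplaneLift q 0) * f 1 (hyperplaneLift q 1) *
      kt (hyperplaneLift q 2) (hyperplaneLift q 3) (hyperplaneLift q 4) ^ (1 / 2 : ℝ) := by
    have : Measurable fun x : Fin 5 → ℝ × ℝ => f 0 (x 0) * f 1 (x 1) *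
      kt (x 2) (x 3) (x 4) ^ (1 / 2 : ℝ) := by fun_prop
    exact this.comp measurable_hyperplaneLift
  have hG : Measurable fun q => f 2 (hyperplaneLift q 2) * f 3 (hyperplaneLift q 3) *
      f 4 (hyperplaneLift q 4) * kp (hyperplaneLift q 0) (hyperplaneLift q 1) ^ (1 / 2 : ℝ) := by
    have : Measurable fun x : Fin 5 → ℝ × ℝ => f 2 (x 2) * f 3 (x 3) * f 4 (x 4) *
      kp (x 0) (x 1) ^ (1 / 2 : ℝ) := by fun_prop
    exact this.comp measurable_hyperplaneLift
  have hCS := ENNReal.lintegral_mul_le_Lp_mul_Lq volume (p := 2) (q := 2)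
    (Real.HolderConjugate.two_two) hF.aemeasurable hG.aemeasurable
  simp only [hsq, mul_pow] at hCS
  have hroot : ∀ a b : ENNReal, (a * b) ^ (1 / 2 : ℝ) = a ^ (1 / 2 : ℝ) * b ^ (1 / 2 : ℝ) :=
    fun a b => ENNReal.mul_rpow_of_nonneg _ _ (by norm_num)
  calc _ = _ := lintegral_congr fun q => ?_
    _ ≤ _ := hCS
    _ ≤ _ := mul_le_mul' (ENNReal.rpow_le_rpow hA (by norm_num))
      (ENNReal.rpow_le_rpow hB (by norm_num))
    _ = _ := ?_
  · simp only [hroot, Fin.prod_univ_five, Pi.mul_apply]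
    ring
  · simp only [Fin.prod_univ_five, hroot]
    ring

lemma deviation_le_of_ne {a b c : ℝ} (hab : a ≠ b) :
    (0 < |c - (a + b + c) / 3| ∧ |c - (a + b + c) / 3| ≤ |a - b|) ∨
      (0 < |b - (a + b + c) / 3| ∧ |b - (a + b + c) / 3| ≤ |a - c|) ∨
      (0 < |a - (a + b + c) / 3| ∧ |a - (a + b + c) / 3| ≤ |b - c|) := by
  obtain ⟨x, hx⟩ : ∃ x, x = a - (a + b + c) / 3 := ⟨_, rfl⟩
  obtain ⟨y, hy⟩ : ∃ y, y = b - (a + b + c) / 3 := ⟨_, rfl⟩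
  obtain ⟨z, hz⟩ : ∃ z, z = c - (a + b + c) / 3 := ⟨_, rfl⟩
  have hxyz : z = -x - y := by rw [hx, hy, hz]; ring
  have h1 : a - b = x - y := by rw [hx, hy]; ring
  have h2 : a - c = x - z := by rw [hx, hz]; ring
  have h3 : b - c = y - z := by rw [hy, hz]; ring
  have hne : x ≠ y := fun h => hab (by linarith)
  rw [← hx, ← hy, ← hz, h1, h2, h3]
  simp only [← sq_le_sq, abs_pos]
  by_contra! h
  obtain ⟨g1, g2, g3⟩ := h
  by_cases hz0 : z = 0
  · have hyx : y = -x := by linarith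
    have hy0 : y ≠ 0 := fun h => hne (by linarith)
    have := g2 hy0
    rw [hz0, hyx] at this
    nlinarith
  · have k1 := g1 hz0
    by_cases hy0 : y = 0
    · have hx0 : x ≠ 0 := fun h => hz0 (by linarith)
      have k3 := g3 hx0
      rw [hy0] at k3 hxyz
      rw [hxyz] at k3
      nlinarith
    · have k2 := g2 hy0
      rw [hxyz] at k1 k2
      nlinarith

lemma min_abs_le_of_sum_eq_zero {z : Fin 5 → ℝ} (hsum : ∑ i, z i = 0) {A : ℝ}
    (hA : ∀ i, |z i| ≤ A) {m : ℝ} (hm : ∀ i, m ≤ |z i|) : m ≤ 2 * A / 3 := by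
  by_contra! h
  rw [Fin.sum_univ_five] at hsum
  have a0 := hA 0; have a1 := hA 1; have a2 := hA 2; have a3 := hA 3; have a4 := hA 4
  have b0 := hm 0; have b1 := hm 1; have b2 := hm 2; have b3 := hm 3; have b4 := hm 4
  rcases abs_cases (z 0) with ⟨h0, _⟩ | ⟨h0, _⟩ <;> rcases abs_cases (z 1) with ⟨h1, _⟩ | ⟨h1, _⟩ <;>
  rcases abs_cases (z 2) with ⟨h2, _⟩ | ⟨h2, _⟩ <;> rcases abs_cases (z 3) with ⟨h3, _⟩ | ⟨h3, _⟩ <;>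
  rcases abs_cases (z 4) with ⟨h4, _⟩ | ⟨h4, _⟩ <;>
  linarith

/-- The frequency configurations in which both kernels are large. -/
def IsTransversal (A : ℝ) (y : Fin 5 → ℝ) : Prop :=
  A / 16 ≤ |y 0 - y 1| ∧ A / 16 ≤ |y 0 + y 1| ∧
    (A / 16 ≤ |y 2 - y 3| ∨ A / 16 ≤ |y 2 + y 3| ∧
      0 < |2 * (y 2 + y 3 + y 4) / 3 - (y 2 + y 3)| ∧
        |2 * (y 2 + y 3 + y 4) / 3 - (y 2 + y 3)| ≤ |y 2 - y 3|)

lemma exists_perm_isTransversal {ξ : Fin 5 → ℝ} (hsum : ∑ i, ξ i = 0) (hinj : Function.Injective ξ) :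
    ∃ σ : Equiv.Perm (Fin 5), IsTransversal ‖ξ‖ (ξ ∘ σ) := by
  set A := ‖ξ‖ with hAdef
  have hA : ∀ i, |ξ i| ≤ A := fun i => norm_le_pi_norm ξ i
  obtain ⟨i₀, hi₀⟩ : ∃ i, A ≤ |ξ i| := by
    by_contra! h
    exact lt_irrefl A ((pi_norm_lt_iff ((abs_nonneg _).trans_lt (h 0))).2 h)
  set τ := Tuple.sort (fun i => |ξ i|) with hτ
  have hmono : Monotone fun i => |ξ (τ i)| := Tuple.monotone_sort fun i => |ξ i|
  set z : Fin 5 → ℝ := fun i => ξ (τ i) with hz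
  have hzsum : ∑ i, z i = 0 := by rw [hz, Equiv.sum_comp τ ξ, hsum]
  have hzA : ∀ i, |z i| ≤ A := fun i => hA _
  have hz4 : A ≤ |z 4| := by
    obtain ⟨j, rfl⟩ := τ.surjective i₀
    exact hi₀.trans (hmono (Fin.le_last j))
  have hz0 : |z 0| ≤ 2 * A / 3 :=
    min_abs_le_of_sum_eq_zero hzsum hzA fun i => hmono (Fin.zero_le i)
  have h12 : |z 1| ≤ |z 2| := hmono (by decide)
  have h23 : |z 2| ≤ |z 3| := hmono (by decide)
  have h01 : |z 0| ≤ |z 1| := hmono (by decide)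
  have hz3 : A / 4 ≤ |z 3| := by
    rw [Fin.sum_univ_five] at hzsum
    have : z 4 = -(z 0 + z 1 + z 2 + z 3) := by linarith
    have h : |z 4| ≤ |z 0| + |z 1| + |z 2| + |z 3| := by
      rw [this, abs_neg]
      exact (abs_add_le _ _).trans (by gcongr; exact abs_add_three _ _ _)
    linarith
  have hA0 : 0 ≤ A := norm_nonneg ξ
  have hp1 : A / 16 ≤ |z 4 - z 0| := by linarith [abs_sub_abs_le_abs_sub (z 4) (z 0)]
  have hp2 : A / 16 ≤ |z 4 + z 0| := by
    have := abs_sub_abs_le_abs_sub (z 4) (-z 0)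
    rw [abs_neg, sub_neg_eq_add] at this
    linarith
  have key : ∀ e : Fin 5 → Fin 5, Function.Injective e → IsTransversal A (z ∘ e) →
      ∃ σ : Equiv.Perm (Fin 5), IsTransversal A (ξ ∘ σ) := by
    intro e he h
    exact ⟨(Equiv.ofBijective e (Finite.injective_iff_bijective.1 he)).trans τ, h⟩
  by_cases c12 : A / 16 ≤ |z 1 - z 2|
  · exact key ![4, 0, 1, 2, 3] (by decide) ⟨hp1, hp2, Or.inl c12⟩
  by_cases c13 : A / 16 ≤ |z 1 - z 3|
  · exact key ![4, 0, 1, 3, 2] (by decide) ⟨hp1, hp2, Or.inl c13⟩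
  by_cases c23 : A / 16 ≤ |z 2 - z 3|
  · exact key ![4, 0, 2, 3, 1] (by decide) ⟨hp1, hp2, Or.inl c23⟩
  push Not at c12 c13 c23
  have hs : ∀ x y, |x - z 3| ≤ A / 16 → |y - z 3| ≤ A / 16 → A / 16 ≤ |x + y| := by
    intro x y hx hy
    rw [abs_le] at hx hy
    rcases abs_cases (z 3) with ⟨h3, _⟩ | ⟨h3, _⟩ <;> rw [h3] at hz3
    · exact le_trans (by linarith) (le_abs_self _)
    · exact le_trans (by linarith) (neg_le_abs _)
  have h33 : |z 3 - z 3| ≤ A / 16 := by simp; positivity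
  have hne : z 1 ≠ z 2 := fun h => by simpa using hinj.comp τ.injective h
  rcases deviation_le_of_ne (c := z 3) hne with h | h | h
  · refine key ![4, 0, 1, 2, 3] (by decide) ⟨hp1, hp2, Or.inr ⟨hs _ _ c13.le c23.le, ?_⟩⟩
    have e : 2 * (z 1 + z 2 + z 3) / 3 - (z 1 + z 2) = z 3 - (z 1 + z 2 + z 3) / 3 := by ring
    rw [← e] at h
    exact h
  · refine key ![4, 0, 1, 3, 2] (by decide) ⟨hp1, hp2, Or.inr ⟨hs _ _ c13.le h33, ?_⟩⟩
    have e : 2 * (z 1 + z 3 + z 2) / 3 - (z 1 + z 3) = z 2 - (z 1 + z 2 + z 3) / 3 := by ring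
    rw [← e] at h
    exact h
  · refine key ![4, 0, 2, 3, 1] (by decide) ⟨hp1, hp2, Or.inr ⟨hs _ _ c23.le h33, ?_⟩⟩
    have e : 2 * (z 2 + z 3 + z 1) / 3 - (z 2 + z 3) = z 1 - (z 1 + z 2 + z 3) / 3 := by ring
    rw [← e] at h
    exact h

lemma rpow_le_mul_of_isTransversal {θ μ ν A : ℝ} (hθ : 0 ≤ θ) (hθ1 : θ ≤ 1) (hμ : 0 ≤ μ)
    (hμν : μ ≤ ν) (hν : ν ≤ 1) (hA : 1 ≤ A) {y : Fin 5 → ℝ} (hyA : ∀ i, |y i| ≤ A)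
    (h : IsTransversal A y) :
    ENNReal.ofReal (A ^ (2 * θ + (1 + θ) / 2 - ν)) ≤ ENNReal.ofReal (16 ^ 3 * 7) *
      (ENNReal.ofReal (|y 0 - y 1| ^ θ * |y 0 + y 1| ^ ((1 + θ) / 2)) *
        (ENNReal.ofReal (|y 2 - y 3| ^ θ) *
          tripleWeight θ μ ν (y 2 + y 3 + y 4, y 2 + y 3))) := by
  have hA0 : 0 < A := by linarith
  obtain ⟨hp1, hp2, hc⟩ := h
  have hpow : ∀ {t : ℝ}, A / 16 ≤ t → ∀ {a : ℝ}, 0 ≤ a → a ≤ 1 → A ^ a / 16 ≤ t ^ a := by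
    intro t ht a ha ha1
    calc A ^ a / 16 ≤ A ^ a / 16 ^ a := by
          gcongr
          exact Real.rpow_le_self_of_one_le (by norm_num) ha1
      _ = (A / 16) ^ a := (Real.div_rpow hA0.le (by norm_num) a).symm
      _ ≤ t ^ a := by gcongr
  have hneg : ∀ {t : ℝ}, |t| ≤ 6 * A → ∀ {a : ℝ}, 0 ≤ a → a ≤ ν →
      A ^ (-ν) / 7 ≤ (1 + |t|) ^ (-a) := by
    intro t ht a ha ha1
    have h0 : 0 < 1 + |t| := by positivity
    calc A ^ (-ν) / 7 ≤ A ^ (-a) / 7 ^ a := by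
          gcongr
          exact Real.rpow_le_self_of_one_le (by norm_num) (by linarith)
      _ = (7 * A) ^ (-a) := by
          rw [Real.mul_rpow (by norm_num) hA0.le, Real.rpow_neg (by norm_num : (0:ℝ) ≤ 7)]
          field_simp
      _ ≤ _ := Real.rpow_le_rpow_of_nonpos h0 (by linarith) (by linarith)
  have hpair : A ^ (θ + (1 + θ) / 2) / 16 ^ 2 ≤ |y 0 - y 1| ^ θ * |y 0 + y 1| ^ ((1 + θ) / 2) := by
    calc A ^ (θ + (1 + θ) / 2) / 16 ^ 2 = A ^ θ / 16 * (A ^ ((1 + θ) / 2) / 16) := by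
          rw [Real.rpow_add hA0]; ring
      _ ≤ _ := by
          gcongr
          · exact hpow hp1 hθ hθ1
          · exact hpow hp2 (by linarith) (by linarith)
  have htriple : ENNReal.ofReal (A ^ (θ - ν) / (16 * 7)) ≤ ENNReal.ofReal (|y 2 - y 3| ^ θ) *
      tripleWeight θ μ ν (y 2 + y 3 + y 4, y 2 + y 3) := by
    have hη : |y 2 + y 3| ≤ 6 * A := by
      linarith [abs_add_le (y 2) (y 3), hyA 2, hyA 3]
    rcases hc with hc | ⟨hc1, hc2, hc3⟩
    · calc ENNReal.ofReal (A ^ (θ - ν) / (16 * 7))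
          = ENNReal.ofReal (A ^ θ / 16 * (A ^ (-ν) / 7)) := by
            rw [sub_eq_add_neg, Real.rpow_add hA0]; congr 1; ring
        _ ≤ ENNReal.ofReal (|y 2 - y 3| ^ θ * (1 + |y 2 + y 3|) ^ (-μ)) := by
            apply ENNReal.ofReal_le_ofReal
            gcongr
            · exact hpow hc hθ hθ1
            · exact hneg hη hμ hμν
        _ = ENNReal.ofReal (|y 2 - y 3| ^ θ) * jw μ (y 2 + y 3) := by
            rw [ENNReal.ofReal_mul (by positivity)]; rfl
        _ ≤ _ := by
            gcongr
            exact le_self_add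
    · set t := 2 * (y 2 + y 3 + y 4) / 3 - (y 2 + y 3) with ht
      have htA : |t| ≤ 6 * A := by
        linarith [abs_sub (y 2) (y 3), hyA 2, hyA 3]
      calc ENNReal.ofReal (A ^ (θ - ν) / (16 * 7))
          ≤ ENNReal.ofReal (1 * (A ^ ((1 + θ) / 2) / 16 * (A ^ (-ν) / 7))) := by
            apply ENNReal.ofReal_le_ofReal
            have : A ^ θ ≤ A ^ ((1 + θ) / 2) := Real.rpow_le_rpow_of_exponent_le hA (by linarith)
            rw [sub_eq_add_neg, Real.rpow_add hA0]
            calc A ^ θ * A ^ (-ν) / (16 * 7) ≤ A ^ ((1 + θ) / 2) * A ^ (-ν) / (16 * 7) := by gcongr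
              _ = _ := by ring
        _ ≤ ENNReal.ofReal ((|y 2 - y 3| ^ θ * |t| ^ (-θ)) *
              (|y 2 + y 3| ^ ((1 + θ) / 2) * (1 + |t|) ^ (-ν))) := by
            apply ENNReal.ofReal_le_ofReal
            gcongr
            · calc (1:ℝ) = |t| ^ θ * |t| ^ (-θ) := by rw [← Real.rpow_add hc2]; simp
                _ ≤ _ := by gcongr
            · exact hpow hc1 (by linarith) (by linarith)
            · exact hneg htA (by linarith) le_rfl
        _ = ENNReal.ofReal (|y 2 - y 3| ^ θ) * (ENNReal.ofReal (|y 2 + y 3| ^ ((1 + θ) / 2)) *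
              (ENNReal.ofReal (|t| ^ (-θ)) * jw ν t)) := by
            unfold jw
            rw [← ENNReal.ofReal_mul (by positivity), ← ENNReal.ofReal_mul (by positivity),
              ← ENNReal.ofReal_mul (by positivity)]
            congr 1; ring
        _ ≤ _ := by
            gcongr
            exact le_add_self
  calc ENNReal.ofReal (A ^ (2 * θ + (1 + θ) / 2 - ν))
      = ENNReal.ofReal (16 ^ 3 * 7) * (ENNReal.ofReal (A ^ (θ + (1 + θ) / 2) / 16 ^ 2) *
          ENNReal.ofReal (A ^ (θ - ν) / (16 * 7))) := by
        rw [← ENNReal.ofReal_mul (by positivity), ← ENNReal.ofReal_mul (by positivity),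
          show 2 * θ + (1 + θ) / 2 - ν = (θ + (1 + θ) / 2) + (θ - ν) by ring, Real.rpow_add hA0]
        congr 1; ring
    _ ≤ _ := by gcongr

lemma ae_injective_hyperplaneLift :
    ∀ᵐ q : Fin 4 → ℝ × ℝ, Function.Injective fun i => (hyperplaneLift q i).2 := by
  have hF : Measurable fun x : Fin 5 → ℝ × ℝ => if (x 1).2 = (x 2).2 then (1 : ENNReal) else 0 :=
    Measurable.ite (measurableSet_eq_fun (by fun_prop) (by fun_prop)) measurable_const
      measurable_const
  have hzero : hyperplaneIntegral (fun x => if (x 1).2 = (x 2).2 then 1 else 0) = 0 := by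
    rw [hyperplaneIntegral_eq hF, lintegral_eq_zero_of_ae_eq_zero]
    refine Filter.Eventually.of_forall fun a => ?_
    have hnull : volume {b : ℝ × ℝ | a.2 = b.2} = 0 := by
      have : {b : ℝ × ℝ | a.2 = b.2} = Set.univ ×ˢ {a.2} := by
        ext b; simp [eq_comm]
      rw [this, Measure.volume_eq_prod, Measure.prod_prod]
      simp
    refine lintegral_eq_zero_of_ae_eq_zero ?_
    have : ∀ᵐ b : ℝ × ℝ, ¬ a.2 = b.2 := by
      rw [ae_iff]; simpa using hnull
    filter_upwards [this] with b hb
    simp [hb, Matrix.cons_val]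
  have hpair : ∀ i j : Fin 5, i ≠ j →
      ∀ᵐ q : Fin 4 → ℝ × ℝ, (hyperplaneLift q i).2 ≠ (hyperplaneLift q j).2 := by
    intro i j hij
    obtain ⟨σ, rfl, rfl⟩ : ∃ σ : Equiv.Perm (Fin 5), σ 1 = i ∧ σ 2 = j := by
      refine ⟨Equiv.swap (Equiv.swap 1 i 2) j * Equiv.swap 1 i, ?_, ?_⟩
      · rw [Equiv.Perm.mul_apply, Equiv.swap_apply_left]
        refine Equiv.swap_apply_of_ne_of_ne (fun h => ?_) hij
        have h' := congrArg (Equiv.swap 1 i) h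
        simp at h'
      · rw [Equiv.Perm.mul_apply, Equiv.swap_apply_left]
    rw [← hyperplaneIntegral_comp_perm σ _ hF, hyperplaneIntegral, lintegral_eq_zero_iff
      (by exact (measurable_comp_perm hF σ).comp measurable_hyperplaneLift)] at hzero
    filter_upwards [hzero] with q hq h
    simp [h] at hq
  have hall : ∀ᵐ q : Fin 4 → ℝ × ℝ, ∀ i j : Fin 5, i ≠ j →
      (hyperplaneLift q i).2 ≠ (hyperplaneLift q j).2 := by
    simp only [ae_all_iff]
    exact hpair
  filter_upwards [hall] with q hq i j h
  by_contra hij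
  exact hq i j hij h

lemma jw_rpow_half (α x : ℝ) : jw α x ^ (1 / 2 : ℝ) = jw (α / 2) x := by
  unfold jw
  rw [ENNReal.ofReal_rpow_of_nonneg (by positivity) (by norm_num),
    ← Real.rpow_mul (by positivity)]
  congr 2; ring

/-- The five-linear estimate dual to the quadrilinear one. -/
lemma exists_hyperplaneIntegral_le {δ : ℝ} (hδ : 0 < δ) (hδ1 : δ ≤ 1 / 100) :
    ∃ C : ENNReal, C ≠ ⊤ ∧ ∀ w : (Fin 5 → ℝ) → ENNReal,
      (∀ ξ, ∑ i, ξ i = 0 →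
        w ξ ≤ if 1 ≤ ‖ξ‖ then ENNReal.ofReal (‖ξ‖ ^ (3 / 2 - 88 * δ)) else 0) →
      ∀ f : Fin 5 → ℝ × ℝ → ENNReal, (∀ i, Measurable (f i)) →
        hyperplaneIntegral (fun x => w (fun i => (x i).2) *
            ∏ i, (jw (1 / 2 - 2 * δ) (airyMod (x i)) * f i (x i))) ≤
          C * ∏ i, (∫⁻ x, f i x ^ 2) ^ (1 / 2 : ℝ) := by
  obtain ⟨Cg, hCg, hg⟩ := exists_lintegral_tripleWeight_le (θ := 1 - 50 * δ) (μ := 26 * δ)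
    (ν := 51 * δ) (by linarith) (by linarith) (by linarith) (by linarith) (by linarith)
    (by linarith)
  obtain ⟨Cp, hCp, hp⟩ := exists_lintegral_pairKernel_le (α := 1 - 4 * δ) (γ := 1 - 20 * δ)
    (θ := 1 - 50 * δ) (by linarith) (by linarith) (by linarith) (by linarith) (by linarith)
  obtain ⟨Ct, hCt, ht⟩ := exists_lintegral_tripleKernel_le (α := 1 - 4 * δ) (β := 1 - 9 * δ)
    (γ := 1 - 20 * δ) (θ := 1 - 50 * δ) (by linarith) (by linarith) (by linarith) (by linarith)
    (by linarith) (by linarith) (by linarith) (measurable_tripleWeight _ _ _) hCg hg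
  set α := 1 - 4 * δ with hα
  set θ := 1 - 50 * δ with hθ
  set kp := pairKernel α θ
  set kt := tripleKernel α θ (tripleWeight θ (26 * δ) (51 * δ)) with hkt
  set K : ENNReal := ENNReal.ofReal (16 ^ 3 * 7) ^ (1 / 2 : ℝ) with hK
  have hK' : K ≠ ⊤ := ENNReal.rpow_ne_top_of_nonneg (by norm_num) ENNReal.ofReal_ne_top
  refine ⟨∑ _σ : Equiv.Perm (Fin 5), K * (Ct * Cp) ^ (1 / 2 : ℝ), ?_, ?_⟩
  · refine (ENNReal.sum_lt_top.2 fun σ _ => ?_).ne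
    exact ENNReal.mul_lt_top hK'.lt_top (ENNReal.rpow_lt_top_of_nonneg (by norm_num)
      (ENNReal.mul_ne_top hCt hCp))
  intro w hw f hf
  have hmp : Measurable fun x : Fin 5 → ℝ × ℝ => kp (x 0) (x 1) :=
    Measurable.comp (f := fun x : Fin 5 → ℝ × ℝ => (x 0, x 1)) (measurable_pairKernel α θ)
      (by fun_prop)
  have hmt : Measurable fun x : Fin 5 → ℝ × ℝ => kt (x 2) (x 3) (x 4) :=
    Measurable.comp (f := fun x : Fin 5 → ℝ × ℝ => (x 2, x 3, x 4))
      (measurable_tripleKernel α θ (measurable_tripleWeight _ _ _)) (by fun_prop)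
  set T : Equiv.Perm (Fin 5) → (Fin 5 → ℝ × ℝ) → ENNReal := fun σ x =>
    (kp (x 0) (x 1) * kt (x 2) (x 3) (x 4)) ^ (1 / 2 : ℝ) * ∏ i, f (σ i) (x i) with hT
  have hTm : ∀ σ, Measurable (T σ) := fun σ => by
    have hm : Measurable fun x : Fin 5 → ℝ × ℝ => ∏ i, f (σ i) (x i) := by
      have : ∀ i, Measurable (f i) := hf
      fun_prop
    exact ((hmp.mul hmt).pow_const _).mul hm
  have hpt : ∀ x : Fin 5 → ℝ × ℝ, ∑ i, (x i).2 = 0 → (Function.Injective fun i => (x i).2) →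
      w (fun i => (x i).2) * ∏ i, (jw (1 / 2 - 2 * δ) (airyMod (x i)) * f i (x i)) ≤
        ∑ σ : Equiv.Perm (Fin 5), K * T σ (x ∘ σ) := by
    intro x hsum hinj
    have hwx := hw _ hsum
    split_ifs at hwx with h1
    swap
    · rw [nonpos_iff_eq_zero.1 hwx, zero_mul]; exact zero_le
    obtain ⟨σ, hσ⟩ := exists_perm_isTransversal hsum hinj
    have hle := rpow_le_mul_of_isTransversal (θ := θ) (μ := 26 * δ) (ν := 51 * δ) (by linarith)
      (by linarith) (by linarith) (by linarith) (by linarith) h1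
      (fun i => norm_le_pi_norm (fun i => (x i).2) (σ i)) hσ
    refine le_trans ?_ (Finset.single_le_sum (f := fun σ : Equiv.Perm (Fin 5) => K * T σ (x ∘ σ))
      (fun _ _ => zero_le) (Finset.mem_univ σ))
    have hroot : ∀ a b : ENNReal, (a * b) ^ (1 / 2 : ℝ) = a ^ (1 / 2 : ℝ) * b ^ (1 / 2 : ℝ) :=
      fun a b => ENNReal.mul_rpow_of_nonneg _ _ (by norm_num)
    have hle2 := ENNReal.rpow_le_rpow hle (show (0:ℝ) ≤ 1 / 2 by norm_num)
    rw [ENNReal.ofReal_rpow_of_nonneg (by positivity) (by norm_num),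
      ← Real.rpow_mul (norm_nonneg _), hroot, ← hK,
      show (2 * θ + (1 + θ) / 2 - 51 * δ) * (1 / 2) = 3 / 2 - 88 * δ by rw [hθ]; ring] at hle2
    have hj : ∏ i, jw (1 / 2 - 2 * δ) (airyMod (x i)) =
        ∏ i, jw α (airyMod (x (σ i))) ^ (1 / 2 : ℝ) := by
      rw [← Equiv.prod_comp σ]
      refine Finset.prod_congr rfl fun i _ => ?_
      rw [jw_rpow_half, hα]
      congr 1; ring
    have hfσ : ∏ i, f i (x i) = ∏ i, f (σ i) (x (σ i)) :=
      (Equiv.prod_comp σ fun i => f i (x i)).symm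
    rw [Finset.prod_mul_distrib, hj, hfσ]
    calc _ ≤ _ * _ := mul_le_mul_left (hwx.trans hle2) _
      _ = _ := by
        simp only [hT, kp, kt, pairKernel, tripleKernel, Function.comp, hroot,
          Fin.prod_univ_five]
        ring
  calc hyperplaneIntegral _ ≤
        hyperplaneIntegral (fun x => ∑ σ : Equiv.Perm (Fin 5), K * T σ (x ∘ σ)) := by
        refine lintegral_mono_ae ?_
        filter_upwards [ae_injective_hyperplaneLift] with q hq
        refine hpt _ ?_ hq
        have := congrArg Prod.snd (sum_hyperplaneLift q)
        simpa [Prod.snd_sum] using this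
    _ = ∑ σ : Equiv.Perm (Fin 5), K * hyperplaneIntegral (T σ) := by
        have hm : ∀ σ, Measurable fun q => T σ (hyperplaneLift q ∘ σ) := fun σ =>
          (measurable_comp_perm (hTm σ) σ).comp measurable_hyperplaneLift
        unfold hyperplaneIntegral
        rw [lintegral_finsetSum _ fun σ _ => (hm σ).const_mul K]
        refine Finset.sum_congr rfl fun σ _ => ?_
        rw [lintegral_const_mul _ (hm σ)]
        congr 1
        exact hyperplaneIntegral_comp_perm σ _ (hTm σ)
    _ ≤ ∑ σ : Equiv.Perm (Fin 5), K * ((Ct * Cp) ^ (1 / 2 : ℝ) *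
          ∏ i, (∫⁻ x, f i x ^ 2) ^ (1 / 2 : ℝ)) := by
        refine Finset.sum_le_sum fun σ _ => ?_
        gcongr
        rw [← Equiv.prod_comp σ fun i => (∫⁻ x, f i x ^ 2) ^ (1 / 2 : ℝ)]
        exact hyperplaneIntegral_sqrt_mul_le (measurable_pairKernel α θ) hp
          (measurable_tripleKernel α θ (measurable_tripleWeight _ _ _)) ht fun i => hf (σ i)
    _ = _ := by simp only [← mul_assoc, Finset.sum_mul]

/-- The multiplier `M12` as a symmetric function of all five frequencies. -/
def symmMultiplier (s N : ℝ) (ξ : Fin 5 → ℝ) : ℝ :=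
  (∑ i, mI s N (ξ i) ^ 2 * ξ i) / ∏ i, mI s N (ξ i)

lemma rpow_le_mI {s N A x : ℝ} (hs : s ≤ 0) (hN : 0 < N) (hNA : N ≤ A) (hx : |x| ≤ A) :
    (A / N) ^ s ≤ mI s N x := by
  unfold mI
  split_ifs with h
  · exact Real.rpow_le_one_of_one_le_of_nonpos ((one_le_div hN).2 hNA) hs
  · push Not at h
    have : 0 < |x| := hN.trans h
    exact Real.rpow_le_rpow_of_nonpos (by positivity) (by gcongr) hs

lemma mI_sq_mul_abs_le {s N A x : ℝ} (hs : -1 / 2 ≤ s) (hN : 0 < N) (hNA : N ≤ A)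
    (hx : |x| ≤ A) : mI s N x ^ 2 * |x| ≤ ((A / N) ^ s) ^ 2 * A := by
  have key : ∀ y, 0 < y → ((y / N) ^ s) ^ 2 * y = N * (y / N) ^ (1 + 2 * s) := by
    intro y hy
    have hyN : 0 < y / N := by positivity
    rw [Real.rpow_add hyN, Real.rpow_one, mul_comm 2 s, Real.rpow_mul hyN.le]
    norm_cast
    field_simp
  have hA : 0 < A := hN.trans_le hNA
  rw [key A hA]
  unfold mI
  split_ifs with h
  · calc 1 ^ 2 * |x| ≤ N * 1 := by linarith
      _ ≤ _ := by
        gcongr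
        exact Real.one_le_rpow ((one_le_div hN).2 hNA) (by linarith)
  · push Not at h
    rw [key _ (hN.trans h)]
    have : 0 ≤ 1 + 2 * s := by linarith
    gcongr

lemma abs_symmMultiplier_le {s ε N : ℝ} (hs : -1 / 6 < s) (hs0 : s < 0) (hε : ε ≤ 1 / 2 + 3 * s)
    (hN : 1 ≤ N) {ξ : Fin 5 → ℝ} (hsum : ∑ i, ξ i = 0) :
    |symmMultiplier s N ξ| ≤
      5 * N ^ (-(1:ℝ) / 2 + ε) * if 1 ≤ ‖ξ‖ then ‖ξ‖ ^ (3 / 2 - ε) else 0 := by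
  have hN0 : 0 < N := by linarith
  have hξ : ∀ i, |ξ i| ≤ ‖ξ‖ := fun i => norm_le_pi_norm ξ i
  set A := ‖ξ‖ with hAdef
  rcases le_or_gt A N with hAN | hAN
  · have h1 : ∀ i, mI s N (ξ i) = 1 := fun i => if_pos ((hξ i).trans hAN)
    have h0 : symmMultiplier s N ξ = 0 := by simp [symmMultiplier, h1, hsum]
    rw [h0, abs_zero]
    split_ifs <;> positivity
  have hA1 : 1 ≤ A := hN.trans hAN.le
  have hA0 : 0 < A := by linarith
  have hq : 1 ≤ A / N := (one_le_div hN0).2 hAN.le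
  have hq0 : 0 < A / N := by positivity
  rw [if_pos hA1]
  set μ := (A / N) ^ s with hμ
  have hμ0 : 0 < μ := by positivity
  have hden : μ ^ 5 ≤ ∏ i, mI s N (ξ i) := by
    calc μ ^ 5 = ∏ _i : Fin 5, μ := by simp
      _ ≤ _ := Finset.prod_le_prod (fun _ _ => hμ0.le)
          fun i _ => rpow_le_mI hs0.le hN0 hAN.le (hξ i)
  have hnum : |∑ i, mI s N (ξ i) ^ 2 * ξ i| ≤ 5 * (μ ^ 2 * A) := by
    calc _ ≤ ∑ i, |mI s N (ξ i) ^ 2 * ξ i| := Finset.abs_sum_le_sum_abs _ _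
      _ ≤ ∑ _i : Fin 5, μ ^ 2 * A := by
          refine Finset.sum_le_sum fun i _ => ?_
          rw [abs_mul, abs_of_nonneg (sq_nonneg _)]
          exact mI_sq_mul_abs_le (by linarith) hN0 hAN.le (hξ i)
      _ = _ := by simp
  have hd0 : 0 < ∏ i, mI s N (ξ i) := (by positivity : 0 < μ ^ 5).trans_le hden
  calc |symmMultiplier s N ξ| = |∑ i, mI s N (ξ i) ^ 2 * ξ i| / ∏ i, mI s N (ξ i) := by
        rw [symmMultiplier, abs_div, abs_of_pos hd0]
    _ ≤ 5 * (μ ^ 2 * A) / μ ^ 5 := by gcongr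
    _ = 5 * A * (A / N) ^ (-3 * s) := by
        have : (A / N) ^ (-3 * s) = (μ ^ 3)⁻¹ := by
          rw [neg_mul, Real.rpow_neg hq0.le, mul_comm, Real.rpow_mul hq0.le]
          norm_cast
        rw [this]
        field_simp
    _ ≤ 5 * A * (A / N) ^ (1 / 2 - ε) := by
        gcongr
        linarith
    _ = _ := by
        rw [Real.div_rpow hA0.le hN0.le, show (3:ℝ) / 2 - ε = 1 + (1 / 2 - ε) by ring,
          Real.rpow_add hA0, Real.rpow_one, show -(1:ℝ) / 2 + ε = -(1 / 2 - ε) by ring,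
          Real.rpow_neg hN0.le]
        field_simp

lemma exists_schwartzMap_FT2 (v : SchwartzMap (ℝ × ℝ) ℂ) :
    ∃ Ψ : SchwartzMap (ℝ × ℝ) ℂ, ∀ x : ℝ × ℝ, FT2 v x.1 x.2 = Ψ x := by
  let e : WithLp 2 (ℝ × ℝ) ≃L[ℝ] ℝ × ℝ := WithLp.prodContinuousLinearEquiv 2 ℝ ℝ ℝ
  let c : (ℝ × ℝ) ≃L[ℝ] ℝ × ℝ :=
    ContinuousLinearEquiv.smulLeft (Units.mk0 (2 * Real.pi)⁻¹ (by positivity))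
  let Φ : SchwartzMap (WithLp 2 (ℝ × ℝ)) ℂ := SchwartzMap.compCLMOfContinuousLinearEquiv ℝ e v
  refine ⟨SchwartzMap.compCLMOfContinuousLinearEquiv ℝ (c.trans e.symm)
    (FourierTransform.fourier Φ), ?_⟩
  intro x
  have h1 : SchwartzMap.compCLMOfContinuousLinearEquiv ℝ (c.trans e.symm)
      (FourierTransform.fourier Φ) x =
      FourierTransform.fourier (Φ : WithLp 2 (ℝ × ℝ) → ℂ)
        (WithLp.toLp 2 ((2 * Real.pi)⁻¹ • x)) := rfl
  rw [h1, Real.fourier_eq', FT2]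
  rw [← (WithLp.volume_preserving_ofLp (U := ℝ) (V := ℝ)).integral_comp
    (MeasurableEquiv.toLp 2 (ℝ × ℝ)).symm.measurableEmbedding]
  refine integral_congr_ae (Filter.Eventually.of_forall fun y => ?_)
  have h2 : Φ y = v (WithLp.ofLp y) := rfl
  simp only [h2, smul_eq_mul, WithLp.prod_inner_apply]
  congr 2
  simp
  field_simp

lemma measurable_FT2 (v : SchwartzMap (ℝ × ℝ) ℂ) : Measurable fun x : ℝ × ℝ => FT2 v x.1 x.2 := by
  obtain ⟨Ψ, h⟩ := exists_schwartzMap_FT2 v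
  simp only [h]
  exact Ψ.continuous.measurable

lemma integrable_wgt_mul_FT2 (v : SchwartzMap (ℝ × ℝ) ℂ) {b : ℝ} (hb : b ≤ 1) :
    Integrable fun x : ℝ × ℝ => wgt 0 b x.1 x.2 * ‖FT2 v x.1 x.2‖ ^ 2 := by
  obtain ⟨Ψ, h⟩ := exists_schwartzMap_FT2 v
  simp only [h]
  obtain ⟨B, hB⟩ := Ψ.decay 0 0
  have hB' : ∀ x, ‖Ψ x‖ ≤ B := fun x => by simpa using hB.2 x
  have hint : Integrable fun x : ℝ × ℝ =>
      B * (‖x‖ ^ 0 * ‖Ψ x‖ + 2 * (‖x‖ ^ 2 * ‖Ψ x‖) + 2 * (‖x‖ ^ 6 * ‖Ψ x‖)) :=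
    (((Ψ.integrable_pow_mul volume 0).add ((Ψ.integrable_pow_mul volume 2).const_mul 2)).add
      ((Ψ.integrable_pow_mul volume 6).const_mul 2)).const_mul B
  have hm : Measurable Ψ := Ψ.continuous.measurable
  refine hint.mono' (Measurable.aestronglyMeasurable ?_) (Filter.Eventually.of_forall fun x => ?_)
  · unfold wgt; fun_prop
  have hσ : 1 ≤ 1 + (x.1 - x.2 ^ 3) ^ 2 := by nlinarith [sq_nonneg (x.1 - x.2 ^ 3)]
  have hw : wgt 0 b x.1 x.2 ≤ 1 + 2 * ‖x‖ ^ 2 + 2 * ‖x‖ ^ 6 := by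
    have h1 : x.1 ^ 2 ≤ ‖x‖ ^ 2 := sq_le_sq' (abs_le.1 (norm_fst_le x)).1 (abs_le.1 (norm_fst_le x)).2
    have h2 : x.2 ^ 2 ≤ ‖x‖ ^ 2 := sq_le_sq' (abs_le.1 (norm_snd_le x)).1 (abs_le.1 (norm_snd_le x)).2
    have h3 : (x.2 ^ 2) ^ 3 ≤ (‖x‖ ^ 2) ^ 3 := by gcongr
    calc wgt 0 b x.1 x.2 ≤ (1 + (x.1 - x.2 ^ 3) ^ 2) ^ (1:ℝ) := by
          rw [wgt, Real.rpow_zero, one_mul]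
          exact Real.rpow_le_rpow_of_exponent_le hσ hb
      _ ≤ _ := by
          rw [Real.rpow_one]
          nlinarith [sq_nonneg (x.1 + x.2 ^ 3)]
  have hw0 : 0 ≤ wgt 0 b x.1 x.2 := by unfold wgt; positivity
  rw [Real.norm_of_nonneg (by positivity)]
  calc wgt 0 b x.1 x.2 * ‖Ψ x‖ ^ 2 ≤ (1 + 2 * ‖x‖ ^ 2 + 2 * ‖x‖ ^ 6) * (B * ‖Ψ x‖) := by
        rw [sq]
        gcongr
        exact hB' x
    _ = _ := by ring

lemma lintegral_sq_le_of_forall_lintegral_mul_le {α : Type*} [MeasurableSpace α] {μ : Measure α}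
    [SigmaFinite μ] {G : α → ENNReal} (hG : Measurable G) {K : ENNReal}
    (h : ∀ g : α → ENNReal, Measurable g →
      ∫⁻ x, G x * g x ∂μ ≤ K * (∫⁻ x, g x ^ 2 ∂μ) ^ (1/2 : ℝ)) :
    ∫⁻ x, G x ^ 2 ∂μ ≤ K ^ 2 := by
  let g : ℕ → α → ENNReal := fun n => (spanningSets μ n).indicator fun x => min (G x) n
  have hg : ∀ n, Measurable (g n) := fun n =>
    (hG.min measurable_const).indicator (measurableSet_spanningSets μ n)
  have hle : ∀ n, ∫⁻ x, g n x ^ 2 ∂μ ≤ K ^ 2 := by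
    intro n
    have hfin : ∫⁻ x, g n x ^ 2 ∂μ ≠ ⊤ := by
      refine ne_top_of_le_ne_top ?_ (lintegral_mono (g := (spanningSets μ n).indicator
        fun _ => (n : ENNReal) ^ 2) fun x => ?_)
      · rw [lintegral_indicator_const (measurableSet_spanningSets μ n)]
        exact ENNReal.mul_ne_top (by simp) (measure_spanningSets_lt_top μ n).ne
      · by_cases hx : x ∈ spanningSets μ n
        · simp only [g, Set.indicator_of_mem hx]
          gcongr
          exact min_le_right _ _
        · simp [g, Set.indicator_of_notMem hx]
    have h1 : ∫⁻ x, g n x ^ 2 ∂μ ≤ K * (∫⁻ x, g n x ^ 2 ∂μ) ^ (1/2 : ℝ) := by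
      refine le_trans (lintegral_mono fun x => ?_) (h (g n) (hg n))
      rw [sq]
      gcongr
      by_cases hx : x ∈ spanningSets μ n
      · simp only [g, Set.indicator_of_mem hx]
        exact min_le_left _ _
      · simp [g, Set.indicator_of_notMem hx]
    set A := ∫⁻ x, g n x ^ 2 ∂μ
    have hA : A = A ^ (1/2 : ℝ) * A ^ (1/2 : ℝ) := by
      rw [← ENNReal.rpow_add_of_nonneg _ _ (by norm_num) (by norm_num)]
      norm_num
    have hAt : A ^ (1/2 : ℝ) ≠ ⊤ := ENNReal.rpow_ne_top_of_nonneg (by norm_num) hfin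
    rcases eq_or_ne (A ^ (1/2 : ℝ)) 0 with h0 | h0
    · rw [hA, h0]; simp
    · have h2 : A ^ (1/2 : ℝ) ≤ K := by
        conv_lhs at h1 => rw [hA]
        exact (ENNReal.mul_le_mul_iff_left h0 hAt).1 h1
      rw [hA, ← sq]
      gcongr
  calc ∫⁻ x, G x ^ 2 ∂μ = ∫⁻ x, Filter.liminf (fun n => g n x ^ 2) Filter.atTop ∂μ := by
        refine lintegral_congr fun x => ?_
        have ht : Filter.Tendsto (fun n => g n x) Filter.atTop (nhds (G x)) := by
          have h1 : Filter.Tendsto (fun n : ℕ => min (G x) (n : ENNReal)) Filter.atTop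
              (nhds (G x)) := by
            simpa using (tendsto_const_nhds (x := G x)).min ENNReal.tendsto_nat_nhds_top
          refine h1.congr' ?_
          have hx : x ∈ ⋃ n, spanningSets μ n := by simp [iUnion_spanningSets]
          obtain ⟨n₀, hn₀⟩ := Set.mem_iUnion.1 hx
          filter_upwards [Filter.eventually_ge_atTop n₀] with n hn
          simp only [g, Set.indicator_of_mem (monotone_spanningSets μ hn hn₀)]
        exact (((ENNReal.continuous_pow 2).tendsto _).comp ht).liminf_eq.symm
    _ ≤ Filter.liminf (fun n => ∫⁻ x, g n x ^ 2 ∂μ) Filter.atTop :=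
        lintegral_liminf_le fun n => (hg n).pow_const 2
    _ ≤ K ^ 2 := by
        refine le_trans (Filter.liminf_le_liminf (Filter.Eventually.of_forall hle)) ?_
        simp

/-- The points of the hyperplane whose coordinate of index `1` is `-X`. -/
def hyperplaneSlice (X : ℝ × ℝ) (r : Fin 3 → ℝ × ℝ) : Fin 5 → ℝ × ℝ :=
  hyperplaneLift (Fin.cons (-X) r)

lemma hyperplaneIntegral_eq_slice {H : (Fin 5 → ℝ × ℝ) → ENNReal} (hH : Measurable H) :
    hyperplaneIntegral H = ∫⁻ X, ∫⁻ r, H (hyperplaneSlice X r) := by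
  unfold hyperplaneIntegral hyperplaneSlice
  rw [lintegral_fin_succ (by exact hH.comp measurable_hyperplaneLift)]
  exact (lintegral_neg_eq_self
    (fun a => ∫⁻ r : Fin 3 → ℝ × ℝ, H (hyperplaneLift (Fin.cons a r)))).symm

lemma measurable_hyperplaneSlice :
    Measurable fun p : (ℝ × ℝ) × (Fin 3 → ℝ × ℝ) => hyperplaneSlice p.1 p.2 := by
  refine measurable_hyperplaneLift.comp (measurable_pi_lambda _ fun i => ?_)
  refine Fin.cases ?_ (fun j => ?_) i
  · simp only [Fin.cons_zero]; fun_prop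
  · simp only [Fin.cons_succ]; fun_prop

lemma measurable_hyperplaneSlice_right (X : ℝ × ℝ) : Measurable (hyperplaneSlice X) :=
  measurable_hyperplaneLift.comp (measurable_cons (-X))

lemma exists_lintegral_slice_sq_le {δ : ℝ} (hδ : 0 < δ) (hδ1 : δ ≤ 1/100) :
    ∃ C : ENNReal, C ≠ ⊤ ∧ ∀ w : (Fin 5 → ℝ) → ENNReal, Measurable w →
      (∀ ξ, ∑ i, ξ i = 0 → w ξ ≤ if 1 ≤ ‖ξ‖ then ENNReal.ofReal (‖ξ‖ ^ (3/2 - 88*δ)) else 0) →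
      ∀ f₀ f₁ f₂ f₃ : ℝ × ℝ → ENNReal, Measurable f₀ → Measurable f₁ → Measurable f₂ →
      Measurable f₃ →
      ∫⁻ X, (jw (1/2 - 2*δ) (airyMod X) *
        ∫⁻ r, w (fun i => (hyperplaneSlice X r i).2) *
          ((jw (1/2 - 2*δ) (airyMod (hyperplaneSlice X r 2)) * f₀ (hyperplaneSlice X r 2)) *
           (jw (1/2 - 2*δ) (airyMod (hyperplaneSlice X r 3)) * f₁ (hyperplaneSlice X r 3)) *
           (jw (1/2 - 2*δ) (airyMod (hyperplaneSlice X r 4)) * f₂ (hyperplaneSlice X r 4)) *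
           (jw (1/2 - 2*δ) (airyMod (hyperplaneSlice X r 0)) * f₃ (hyperplaneSlice X r 0)))) ^ 2 ≤
        (C * ((∫⁻ x, f₀ x ^ 2) ^ (1/2 : ℝ) * (∫⁻ x, f₁ x ^ 2) ^ (1/2 : ℝ) *
          (∫⁻ x, f₂ x ^ 2) ^ (1/2 : ℝ) * (∫⁻ x, f₃ x ^ 2) ^ (1/2 : ℝ))) ^ 2 := by
  obtain ⟨C, hC, h⟩ := exists_hyperplaneIntegral_le hδ hδ1
  refine ⟨C, hC, fun w hwm hw f₀ f₁ f₂ f₃ h₀ h₁ h₂ h₃ => ?_⟩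
  have hj : Measurable fun x : ℝ × ℝ => jw (1/2 - 2*δ) (airyMod x) :=
    (measurable_jw _).comp measurable_airyMod
  have hkey : ∀ {k : ℝ × ℝ → ENNReal}, Measurable k → ∀ i : Fin 5,
      Measurable fun x : Fin 5 → ℝ × ℝ => jw (1/2 - 2*δ) (airyMod (x i)) * k (x i) :=
    fun hk i => (hj.mul hk).comp (measurable_pi_apply i)
  have hwm' : Measurable fun x : Fin 5 → ℝ × ℝ => w (fun i => (x i).2) := by
    refine hwm.comp (measurable_pi_lambda _ fun i => ?_)
    fun_prop
  let P : (Fin 5 → ℝ × ℝ) → ENNReal := fun x => w (fun i => (x i).2) *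
    ((jw (1/2 - 2*δ) (airyMod (x 2)) * f₀ (x 2)) * (jw (1/2 - 2*δ) (airyMod (x 3)) * f₁ (x 3)) *
     (jw (1/2 - 2*δ) (airyMod (x 4)) * f₂ (x 4)) * (jw (1/2 - 2*δ) (airyMod (x 0)) * f₃ (x 0)))
  have hP : Measurable P :=
    hwm'.mul ((((hkey h₀ 2).mul (hkey h₁ 3)).mul (hkey h₂ 4)).mul (hkey h₃ 0))
  have hPs : Measurable fun p : (ℝ × ℝ) × (Fin 3 → ℝ × ℝ) => P (hyperplaneSlice p.1 p.2) :=
    hP.comp measurable_hyperplaneSlice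
  refine lintegral_sq_le_of_forall_lintegral_mul_le
    (G := fun X => jw (1/2 - 2*δ) (airyMod X) * ∫⁻ r, P (hyperplaneSlice X r))
    (hj.mul hPs.lintegral_prod_right') fun g hg => ?_
  have hgn : Measurable fun x => g (-x) := hg.comp measurable_neg
  let f : Fin 5 → ℝ × ℝ → ENNReal := ![f₃, fun x => g (-x), f₀, f₁, f₂]
  have hf : ∀ i, Measurable (f i) := by
    intro i
    fin_cases i
    exacts [h₃, hgn, h₀, h₁, h₂]
  have hmain := h w hw f hf
  have hn : ∫⁻ x, g (-x) ^ 2 = ∫⁻ x, g x ^ 2 := lintegral_neg_eq_self (fun x => g x ^ 2)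
  have hH : Measurable fun x : Fin 5 → ℝ × ℝ => w (fun i => (x i).2) *
      ∏ i, (jw (1/2 - 2*δ) (airyMod (x i)) * f i (x i)) :=
    hwm'.mul (Finset.measurable_fun_prod _ fun i _ => hkey (hf i) i)
  rw [hyperplaneIntegral_eq_slice hH] at hmain
  calc ∫⁻ X, jw (1/2 - 2*δ) (airyMod X) * (∫⁻ r, P (hyperplaneSlice X r)) * g X
      = ∫⁻ X, ∫⁻ r, w (fun i => (hyperplaneSlice X r i).2) *
        ∏ i, (jw (1/2 - 2*δ) (airyMod (hyperplaneSlice X r i)) * f i (hyperplaneSlice X r i)) := by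
        refine lintegral_congr fun X => ?_
        have hm : Measurable fun r => P (hyperplaneSlice X r) :=
          hP.comp (measurable_hyperplaneSlice_right X)
        rw [mul_right_comm, ← lintegral_const_mul _ hm]
        refine lintegral_congr fun r => ?_
        have h1 : hyperplaneSlice X r 1 = -X := rfl
        have h2 : airyMod (-X) = -airyMod X := by
          simp only [airyMod, Prod.fst_neg, Prod.snd_neg]; ring
        have h3 : f 0 = f₃ ∧ f 1 = (fun x => g (-x)) ∧ f 2 = f₀ ∧ f 3 = f₁ ∧ f 4 = f₂ :=
          ⟨rfl, rfl, rfl, rfl, rfl⟩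
        rw [Fin.prod_univ_five, h3.1, h3.2.1, h3.2.2.1, h3.2.2.2.1, h3.2.2.2.2, h1, h2, jw_neg]
        simp only [P, neg_neg]
        ring
    _ ≤ _ := hmain
    _ = _ := by
        have h3 : f 0 = f₃ ∧ f 1 = (fun x => g (-x)) ∧ f 2 = f₀ ∧ f 3 = f₁ ∧ f 4 = f₂ :=
          ⟨rfl, rfl, rfl, rfl, rfl⟩
        rw [Fin.prod_univ_five, h3.1, h3.2.1, h3.2.2.1, h3.2.2.2.1, h3.2.2.2.2, hn]
        ring

/-- The frequency weight that dominates the multiplier `symmMultiplier`. -/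
def freqWeight (ε : ℝ) (ξ : Fin 5 → ℝ) : ENNReal :=
  if 1 ≤ ‖ξ‖ then ENNReal.ofReal (‖ξ‖ ^ (3/2 - ε)) else 0

lemma measurable_freqWeight (ε : ℝ) : Measurable (freqWeight ε) :=
  Measurable.ite (measurableSet_le measurable_const measurable_norm) (by fun_prop) measurable_const

lemma hyperplaneSlice_zero (X : ℝ × ℝ) (r : Fin 3 → ℝ × ℝ) :
    hyperplaneSlice X r 0 = X - ∑ i, r i := by
  have h : hyperplaneSlice X r 0 = -∑ i, (Fin.cons (-X) r : Fin 4 → ℝ × ℝ) i := rfl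
  rw [h, Fin.sum_univ_succ]
  simp only [Fin.cons_zero, Fin.cons_succ]
  abel

lemma M12_padTot_eq (s N : ℝ) (X : ℝ × ℝ) (r : Fin 3 → ℝ × ℝ) :
    M12 s N (padTot 4 X.2 fun i => (r i).2) =
      symmMultiplier s N fun i => (hyperplaneSlice X r i).2 := by
  have h0 : (hyperplaneSlice X r 0).2 = X.2 - ∑ i, (r i).2 := by
    rw [hyperplaneSlice_zero, Prod.snd_sub, Prod.snd_sum]
  have h1 : (hyperplaneSlice X r 1).2 = -X.2 := rfl
  have h2 : hyperplaneSlice X r 2 = r 0 := rfl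
  have h3 : hyperplaneSlice X r 3 = r 1 := rfl
  have h4 : hyperplaneSlice X r 4 = r 2 := rfl
  have p0 : padTot 4 X.2 (fun i => (r i).2) 0 = (r 0).2 := rfl
  have p1 : padTot 4 X.2 (fun i => (r i).2) 1 = (r 1).2 := rfl
  have p2 : padTot 4 X.2 (fun i => (r i).2) 2 = (r 2).2 := rfl
  have p3 : padTot 4 X.2 (fun i => (r i).2) 3 = X.2 - ∑ i, (r i).2 := rfl
  rw [symmMultiplier, Fin.sum_univ_five, Fin.prod_univ_five, h0, h1, h2, h3, h4, M12, p0, p1, p2, p3]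
  have htot : (r 0).2 + (r 1).2 + (r 2).2 + (X.2 - ∑ i, (r i).2) = X.2 := by
    rw [Fin.sum_univ_three]; ring
  rw [htot]
  congr 1 <;> ring

lemma enorm_convFT_le {s ε N : ℝ} (hs : -1/6 < s) (hs0 : s < 0) (hε : ε ≤ 1/2 + 3*s) (hN : 1 ≤ N)
    (u : Fin 4 → ℝ × ℝ → ℂ) (X : ℝ × ℝ) :
    ‖convFT 4 (fun ξ => (M12 s N ξ : ℂ)) u X.1 X.2‖ₑ ≤
      ENNReal.ofReal (5 * N ^ (-(1:ℝ)/2 + ε)) *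
        ∫⁻ r, freqWeight ε (fun i => (hyperplaneSlice X r i).2) *
          (‖FT2 (u 0) (hyperplaneSlice X r 2).1 (hyperplaneSlice X r 2).2‖ₑ *
           ‖FT2 (u 1) (hyperplaneSlice X r 3).1 (hyperplaneSlice X r 3).2‖ₑ *
           ‖FT2 (u 2) (hyperplaneSlice X r 4).1 (hyperplaneSlice X r 4).2‖ₑ *
           ‖FT2 (u 3) (hyperplaneSlice X r 0).1 (hyperplaneSlice X r 0).2‖ₑ) := by
  rw [← lintegral_const_mul' _ _ ENNReal.ofReal_ne_top]
  refine (enorm_integral_le_lintegral_enorm _).trans (lintegral_mono fun r => ?_)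
  have h0 : (hyperplaneSlice X r 0).2 = X.2 - ∑ i, (r i).2 := by
    rw [hyperplaneSlice_zero, Prod.snd_sub, Prod.snd_sum]
  have h0' : (hyperplaneSlice X r 0).1 = X.1 - ∑ i, (r i).1 := by
    rw [hyperplaneSlice_zero, Prod.fst_sub, Prod.fst_sum]
  have hsum : ∑ i, (hyperplaneSlice X r i).2 = 0 := by
    rw [← Prod.snd_sum, hyperplaneSlice, sum_hyperplaneLift, Prod.snd_zero]
  beta_reduce
  rw [M12_padTot_eq, enorm_mul, Fin.prod_univ_four, enorm_mul, enorm_mul, enorm_mul,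
    ← mul_assoc (ENNReal.ofReal _),
    h0, h0']
  refine mul_le_mul' ?_ le_rfl
  rw [← ofReal_norm, Complex.norm_real, Real.norm_eq_abs]
  refine (ENNReal.ofReal_le_ofReal (abs_symmMultiplier_le hs hs0 hε hN hsum)).trans ?_
  rw [ENNReal.ofReal_mul (by positivity), freqWeight]
  gcongr
  split_ifs <;> simp

lemma one_add_abs_rpow_sq_le {a : ℝ} (ha : 0 ≤ a) (ha1 : a ≤ 1) (x : ℝ) :
    ((1 + |x|) ^ a) ^ 2 ≤ 4 * (1 + x ^ 2) ^ a := by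
  have h1 : (1 + |x|) ^ 2 ≤ 2 * (1 + x ^ 2) := by
    rw [← sq_abs x]
    nlinarith [sq_nonneg (1 - |x|)]
  have h2 : (2:ℝ) ^ a ≤ 2 := by
    simpa using Real.rpow_le_rpow_of_exponent_le (by norm_num : (1:ℝ) ≤ 2) ha1
  calc ((1 + |x|) ^ a) ^ 2 = ((1 + |x|) ^ 2) ^ a := by
        rw [← Real.rpow_natCast, ← Real.rpow_natCast, ← Real.rpow_mul (by positivity),
          ← Real.rpow_mul (by positivity), mul_comm]
    _ ≤ (2 * (1 + x ^ 2)) ^ a := by gcongr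
    _ = 2 ^ a * (1 + x ^ 2) ^ a := Real.mul_rpow (by norm_num) (by positivity)
    _ ≤ 4 * (1 + x ^ 2) ^ a := by gcongr; linarith

lemma ofReal_wgt_neg_le {a : ℝ} (ha : 0 ≤ a) (ha1 : a ≤ 1) (X : ℝ × ℝ) :
    ENNReal.ofReal (wgt 0 (-a) X.1 X.2) ≤ (2 * jw a (airyMod X)) ^ 2 := by
  have h := one_add_abs_rpow_sq_le ha ha1 (X.1 - X.2 ^ 3)
  have h2 : (2 : ENNReal) = ENNReal.ofReal 2 := by simp
  rw [jw, airyMod, h2, ← ENNReal.ofReal_mul (by norm_num), ← ENNReal.ofReal_pow (by positivity)]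
  refine ENNReal.ofReal_le_ofReal ?_
  rw [wgt, Real.rpow_zero, one_mul, Real.rpow_neg (by positivity), Real.rpow_neg (by positivity),
    mul_pow, inv_pow, ← div_eq_mul_inv, inv_eq_one_div, div_le_div_iff₀ (by positivity)
    (by positivity)]
  linarith

/-- The Fourier transform of `u` weighted by `(1 + |τ - ξ³|) ^ a`. -/
def weightedFT (a : ℝ) (u : ℝ × ℝ → ℂ) (x : ℝ × ℝ) : ENNReal :=
  ENNReal.ofReal ((1 + |airyMod x|) ^ a) * ‖FT2 u x.1 x.2‖ₑ

lemma jw_mul_weightedFT (a : ℝ) (u : ℝ × ℝ → ℂ) (x : ℝ × ℝ) :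
    jw a (airyMod x) * weightedFT a u x = ‖FT2 u x.1 x.2‖ₑ := by
  rw [jw, weightedFT, ← mul_assoc, ← ENNReal.ofReal_mul (by positivity),
    ← Real.rpow_add (by positivity)]
  simp

lemma measurable_weightedFT (a : ℝ) (v : SchwartzMap (ℝ × ℝ) ℂ) : Measurable (weightedFT a v) := by
  have h1 := measurable_FT2 v
  have h2 := measurable_airyMod
  unfold weightedFT
  fun_prop

lemma lintegral_weightedFT_sq_le {a b : ℝ} (ha : 0 ≤ a) (hab : a ≤ b) (hb : b ≤ 1)
    (v : SchwartzMap (ℝ × ℝ) ℂ) :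
    (∫⁻ x, weightedFT a v x ^ 2) ^ (1/2 : ℝ) ≤ ENNReal.ofReal (2 * Xnorm 0 b v) := by
  have hI := integrable_wgt_mul_FT2 v hb
  have hpos : ∀ x : ℝ × ℝ, 0 ≤ wgt 0 b x.1 x.2 * ‖FT2 v x.1 x.2‖ ^ 2 := fun x => by
    unfold wgt; positivity
  have h1 : ∫⁻ x, weightedFT a v x ^ 2 ≤ ENNReal.ofReal ((2 * Xnorm 0 b v) ^ 2) := by
    calc ∫⁻ x, weightedFT a v x ^ 2
        ≤ ∫⁻ x : ℝ × ℝ, ENNReal.ofReal (4 * (wgt 0 b x.1 x.2 * ‖FT2 v x.1 x.2‖ ^ 2)) := by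
          refine lintegral_mono fun x => ?_
          rw [weightedFT, ← ofReal_norm, ← ENNReal.ofReal_mul (by positivity),
            ← ENNReal.ofReal_pow (by positivity), mul_pow, ← mul_assoc]
          refine ENNReal.ofReal_le_ofReal ?_
          gcongr
          refine (one_add_abs_rpow_sq_le ha (hab.trans hb) _).trans ?_
          rw [wgt, Real.rpow_zero, one_mul, airyMod]
          gcongr
          nlinarith [sq_nonneg (x.1 - x.2 ^ 3)]
      _ = ENNReal.ofReal ((2 * Xnorm 0 b v) ^ 2) := by
          rw [← ofReal_integral_eq_lintegral_ofReal (hI.const_mul 4)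
            (Filter.Eventually.of_forall fun x => mul_nonneg (by norm_num) (hpos x)),
            integral_const_mul, mul_pow, Xnorm, Real.sq_sqrt (integral_nonneg hpos)]
          norm_num
  calc (∫⁻ x, weightedFT a v x ^ 2) ^ (1/2 : ℝ)
      ≤ ENNReal.ofReal ((2 * Xnorm 0 b v) ^ 2) ^ (1/2 : ℝ) := by gcongr
    _ = ENNReal.ofReal (2 * Xnorm 0 b v) := by
        have h0 : 0 ≤ 2 * Xnorm 0 b v := by unfold Xnorm; positivity
        rw [ENNReal.ofReal_rpow_of_nonneg (by positivity) (by norm_num), ← Real.sqrt_eq_rpow,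
          Real.sqrt_sq h0]

lemma lintegral_wgt_mul_convFT_le {s δ : ℝ} (hs : -1/6 < s) (hs0 : s < 0) (hδ : 0 < δ)
    (hδ1 : δ ≤ 1/100) (hδs : 88*δ ≤ 1/2 + 3*s) :
    ∃ C : ENNReal, C ≠ ⊤ ∧ ∀ N : ℝ, 1 ≤ N → ∀ v : Fin 4 → SchwartzMap (ℝ × ℝ) ℂ,
      ∫⁻ X : ℝ × ℝ, ENNReal.ofReal (wgt 0 (-(1/2 - 2*δ)) X.1 X.2 *
        ‖convFT 4 (fun ξ => (M12 s N ξ : ℂ)) (fun j => ⇑(v j)) X.1 X.2‖ ^ 2) ≤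
      (2 * ENNReal.ofReal (5 * N ^ (-(1:ℝ)/2 + 88*δ)) *
        (C * ∏ j, ENNReal.ofReal (2 * Xnorm 0 (1/2 + δ) (v j)))) ^ 2 := by
  obtain ⟨C, hC, h⟩ := exists_lintegral_slice_sq_le hδ hδ1
  refine ⟨C, hC, fun N hN v => ?_⟩
  have hv : ∀ j, (∫⁻ x, weightedFT (1/2 - 2*δ) (v j) x ^ 2) ^ (1/2 : ℝ) ≤
      ENNReal.ofReal (2 * Xnorm 0 (1/2 + δ) (v j)) := fun j =>
    lintegral_weightedFT_sq_le (by linarith) (by linarith) (by linarith) (v j)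
  have hw := h (freqWeight (88*δ)) (measurable_freqWeight _) (fun ξ _ => le_rfl)
    (weightedFT (1/2 - 2*δ) (v 0)) (weightedFT (1/2 - 2*δ) (v 1)) (weightedFT (1/2 - 2*δ) (v 2))
    (weightedFT (1/2 - 2*δ) (v 3)) (measurable_weightedFT _ _) (measurable_weightedFT _ _)
    (measurable_weightedFT _ _) (measurable_weightedFT _ _)
  simp only [jw_mul_weightedFT] at hw
  set K := ENNReal.ofReal (5 * N ^ (-(1:ℝ)/2 + 88*δ)) with hK
  have hKt : (2 * K) ^ 2 ≠ ⊤ :=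
    ENNReal.pow_ne_top (ENNReal.mul_ne_top (by simp) ENNReal.ofReal_ne_top)
  calc _ ≤ ∫⁻ X, (2 * K) ^ 2 * (jw (1/2 - 2*δ) (airyMod X) *
        ∫⁻ r, freqWeight (88*δ) (fun i => (hyperplaneSlice X r i).2) *
          (‖FT2 (v 0) (hyperplaneSlice X r 2).1 (hyperplaneSlice X r 2).2‖ₑ *
           ‖FT2 (v 1) (hyperplaneSlice X r 3).1 (hyperplaneSlice X r 3).2‖ₑ *
           ‖FT2 (v 2) (hyperplaneSlice X r 4).1 (hyperplaneSlice X r 4).2‖ₑ *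
           ‖FT2 (v 3) (hyperplaneSlice X r 0).1 (hyperplaneSlice X r 0).2‖ₑ)) ^ 2 := by
        refine lintegral_mono fun X => ?_
        have h1 := ofReal_wgt_neg_le (a := 1/2 - 2*δ) (by linarith) (by linarith) X
        have h2 := enorm_convFT_le hs hs0 hδs hN (fun j => ⇑(v j)) X
        rw [ENNReal.ofReal_mul (by unfold wgt; positivity), ENNReal.ofReal_pow (norm_nonneg _),
          ofReal_norm]
        refine (mul_le_mul' h1 (pow_le_pow_left₀ zero_le h2 2)).trans (le_of_eq ?_)
        ring
    _ ≤ (2 * K) ^ 2 * (C * ∏ j, ENNReal.ofReal (2 * Xnorm 0 (1/2 + δ) (v j))) ^ 2 := by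
        rw [lintegral_const_mul' _ _ hKt, Fin.prod_univ_four]
        gcongr
        refine hw.trans ?_
        gcongr
        exacts [hv 0, hv 1, hv 2, hv 3]
    _ = _ := (mul_pow _ _ _).symm

lemma integral_le_of_lintegral_ofReal_le {α : Type*} [MeasurableSpace α] {μ : Measure α}
    {f : α → ℝ} {c : ℝ} (hc : 0 ≤ c) (h : ∫⁻ x, ENNReal.ofReal (f x) ∂μ ≤ ENNReal.ofReal c) :
    ∫ x, f x ∂μ ≤ c := by
  by_cases hf : Integrable f μ
  · rw [integral_eq_lintegral_pos_part_sub_lintegral_neg_part hf]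
    have h1 := ENNReal.toReal_mono ENNReal.ofReal_ne_top h
    rw [ENNReal.toReal_ofReal hc] at h1
    have h2 : 0 ≤ (∫⁻ x, ENNReal.ofReal (-f x) ∂μ).toReal := ENNReal.toReal_nonneg
    linarith
  · rwa [integral_undef hf]

theorem GPS_quadrilinear_estimate (s : ℝ) (hs : -1/6 < s) (hs0 : s < 0) :
    ∃ ε₀ > 0, ∀ ε : ℝ, 0 < ε → ε < ε₀ →
      ∃ b b' C : ℝ, 1/2 < b ∧ b < 1 ∧ b - 1 < b' ∧ b' < 0 ∧ 0 < C ∧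
        ∀ N : ℝ, 1 ≤ N → ∀ v : Fin 4 → SchwartzMap (ℝ × ℝ) ℂ,
          XnormM 0 b' 4 (fun ξ => (M12 s N ξ : ℂ)) (fun j => ⇑(v j)) ≤
            C * N ^ (-(1:ℝ)/2 + ε) * ∏ j, Xnorm 0 b ⇑(v j) := by
  refine ⟨1/2 + 3*s, by linarith, fun ε hε hε0 => ?_⟩
  obtain ⟨δ, rfl⟩ : ∃ δ, ε = 88*δ := ⟨ε/88, by ring⟩
  obtain ⟨C, hC, h⟩ := lintegral_wgt_mul_convFT_le (δ := δ) hs hs0 (by linarith) (by linarith)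
    hε0.le
  refine ⟨1/2 + δ, -(1/2 - 2*δ), 160 * C.toReal + 1, by linarith, by linarith, by linarith,
    by linarith, by positivity, fun N hN v => ?_⟩
  have hX : ∀ j, 0 ≤ Xnorm 0 (1/2 + δ) (v j) := fun j => Real.sqrt_nonneg _
  have hP : 0 ≤ ∏ j, Xnorm 0 (1/2 + δ) (v j) := Finset.prod_nonneg fun j _ => hX j
  have hN0 : 0 < N := by linarith
  set R := 160 * C.toReal * N ^ (-(1:ℝ)/2 + 88*δ) * ∏ j, Xnorm 0 (1/2 + δ) (v j) with hR
  have hR0 : 0 ≤ R := by positivity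
  have hbound : (2 * ENNReal.ofReal (5 * N ^ (-(1:ℝ)/2 + 88*δ)) *
      (C * ∏ j, ENNReal.ofReal (2 * Xnorm 0 (1/2 + δ) (v j)))) ^ 2 = ENNReal.ofReal (R ^ 2) := by
    rw [ENNReal.ofReal_pow hR0]
    congr 1
    rw [← ENNReal.ofReal_prod_of_nonneg (fun j _ => mul_nonneg zero_le_two (hX j)),
      ← ENNReal.ofReal_toReal hC, ← ENNReal.ofReal_mul ENNReal.toReal_nonneg,
      show (2 : ENNReal) = ENNReal.ofReal 2 by simp, ← ENNReal.ofReal_mul (by norm_num),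
      ← ENNReal.ofReal_mul (by positivity)]
    congr 1
    rw [hR, Finset.prod_mul_distrib, Finset.prod_const]
    simp only [Finset.card_univ, Fintype.card_fin]
    ring
  have hint : ∫ q : ℝ × ℝ, wgt 0 (-(1/2 - 2*δ)) q.1 q.2 *
      ‖convFT 4 (fun ξ => (M12 s N ξ : ℂ)) (fun j => ⇑(v j)) q.1 q.2‖ ^ 2 ≤ R ^ 2 := by
    have h1 := h N hN v
    rw [hbound] at h1
    exact integral_le_of_lintegral_ofReal_le (by positivity) h1
  calc XnormM 0 (-(1/2 - 2*δ)) 4 (fun ξ => (M12 s N ξ : ℂ)) (fun j => ⇑(v j))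
      ≤ R := by
        rw [XnormM]
        exact (Real.sqrt_le_sqrt hint).trans_eq (Real.sqrt_sq hR0)
    _ ≤ _ := by
        rw [hR]
        gcongr
        linarith

end
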